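/- Let ℓ ≥ 2 be an integer, λ ∈ (0,1], c, c₁ ∈ (0,1), δ > 0 and K ≥ 1, and set θ₁(c₁) = max{2c₁ − 1/2, −c₁, −1}. There is a constant C > 0 such that for every integer Q ≥ 2 and every interval I ⊆ [0,1] with K⁻¹·Q^{−c} ≤ |I| ≤ K·Q^{−c}, one has |A_{I,Q}(λ) − c_I·A(ℓ)·I₁(λ)| ≤ C·Q^{δ+θ₁(c₁)}, where A_{I,Q}(λ) = Σ 1/(q·q′·(1+γ²)), the sum being over all pairs γ = a/q < γ′ = a′/q′ of consecutive fractions in F_Q such that γ, γ′ ∈ (I ∩ F_Q) ∖ F^{(ℓ)} and min{q,q′} > λQ, and I₁(λ) = ∫_λ^1 (1/x)·ln(1/max{λ, 1−x}) dx. Moreover I₁(λ) = (ln λ)² for λ ∈ [1/2,1] and I₁(λ) = ln(1−λ)·ln λ + ∫_λ^{1−λ} (1/x)·ln(1/(1−x)) dx for λ ∈ (0,1/2]. -/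

import Mathlib

open MeasureTheory Real Set Filter

noncomputable def zeta2 : ℝ := π ^ 2 / 6

noncomputable def Cconst (l : ℕ) : ℝ :=
  ((Nat.totient l : ℝ) / l) * ∏' p : {p : ℕ // p.Prime ∧ ¬ p ∣ l}, (1 - 1 / (p.1 : ℝ) ^ 2)

noncomputable def Aconst (l : ℕ) : ℝ := 1 / zeta2 - 2 * Cconst l / l

/-- The Farey fractions of order `Q`: rationals `a/q` in lowest terms with `0 < a ≤ q ≤ Q`,
i.e. rationals in `(0,1]` with denominator at most `Q`. -/
def FareyQ (Q : ℕ) : Set ℚ := {x | 0 < x ∧ x ≤ 1 ∧ x.den ≤ Q}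

/-- `F^{(ℓ)}`: fractions `a/q` in lowest terms with `0 < a ≤ q` and `ℓ ∣ (q - a)`. -/
def FareyCong (l : ℕ) : Set ℚ := {x | 0 < x ∧ x ≤ 1 ∧ (l : ℤ) ∣ ((x.den : ℤ) - x.num)}

/-- `γ < γ'` are consecutive elements of `F_Q`. -/
def ConsecFarey (Q : ℕ) (γ γ' : ℚ) : Prop :=
  γ ∈ FareyQ Q ∧ γ' ∈ FareyQ Q ∧ γ < γ' ∧ ∀ z ∈ FareyQ Q, ¬ (γ < z ∧ z < γ')

/-- The sum `A_{I,Q}(λ)` over pairs of consecutive Farey fractions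
`γ = a/q < γ' = a'/q'` in `(I ∩ F_Q) ∖ F^{(ℓ)}` with `min{q,q'} > λQ`
of `1/(q·q'·(1+γ²))`. -/
noncomputable def Asum (l Q : ℕ) (I : Set ℝ) (lam : ℝ) : ℝ :=
  ∑' p : {p : ℚ × ℚ // ConsecFarey Q p.1 p.2 ∧ (p.1 : ℝ) ∈ I ∧ (p.2 : ℝ) ∈ I ∧
      p.1 ∉ FareyCong l ∧ p.2 ∉ FareyCong l ∧ lam * Q < (min p.1.den p.2.den : ℝ)},
    1 / ((p.1.1.den : ℝ) * (p.1.2.den : ℝ) * (1 + (p.1.1 : ℝ) ^ 2))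

/-- `I₁(λ) = ∫_λ^1 (1/x)·ln(1/max{λ, 1-x}) dx`. -/
noncomputable def I1 (lam : ℝ) : ℝ :=
  ∫ x in lam..1, (1 / x) * Real.log (1 / max lam (1 - x))

/-- The Kloosterman sum `S(m,n;q)`. -/
noncomputable def kloosterman {q : ℕ} [NeZero q] (m n : ZMod q) : ℂ :=
  ∑ x : (ZMod q)ˣ, ZMod.stdAddChar (m * (x : ZMod q) + n * ((x⁻¹ : (ZMod q)ˣ) : ZMod q))

theorem kloosterman_mul_unit {q : ℕ} [NeZero q] (m n : ZMod q) (t : (ZMod q)ˣ) :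
    kloosterman (m * (t : ZMod q)) (n * ((t⁻¹ : (ZMod q)ˣ) : ZMod q)) = kloosterman m n := by
  unfold kloosterman
  refine Fintype.sum_equiv (Equiv.mulLeft t) _ _ fun x => ?_
  simp only [Equiv.coe_mulLeft, Units.val_mul, mul_inv]
  congr 1
  ring

theorem conj_kloosterman {q : ℕ} [NeZero q] (m n : ZMod q) :
    (starRingEnd ℂ) (kloosterman m n) = kloosterman (-m) (-n) := by
  unfold kloosterman
  rw [map_sum]
  refine Finset.sum_congr rfl fun x _ => ?_
  rw [← AddChar.map_neg_eq_conj]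
  congr 1
  ring

/-- Solutions of `x₁ + x₂ = x₃ + x₄`, `1/x₁ + 1/x₂ = 1/x₃ + 1/x₄` in units modulo `q`. -/
def unitQuadruples (q : ℕ) [NeZero q] :
    Finset ((ZMod q)ˣ × (ZMod q)ˣ × (ZMod q)ˣ × (ZMod q)ˣ) :=
  Finset.univ.filter fun x =>
    (x.1 : ZMod q) + x.2.1 - x.2.2.1 - x.2.2.2 = 0 ∧
    ((x.1⁻¹ : (ZMod q)ˣ) : ZMod q) + ((x.2.1⁻¹ : (ZMod q)ˣ) : ZMod q)
      - ((x.2.2.1⁻¹ : (ZMod q)ˣ) : ZMod q) - ((x.2.2.2⁻¹ : (ZMod q)ˣ) : ZMod q) = 0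

theorem sum_norm_kloosterman_pow_four (q : ℕ) [NeZero q] :
    ∑ m : ZMod q, ∑ n : ZMod q, ‖kloosterman m n‖ ^ 4 = (q : ℝ) ^ 2 * (unitQuadruples q).card := by
  have key : ∀ m n : ZMod q, ((‖kloosterman m n‖ ^ 4 : ℝ) : ℂ) =
      ∑ x : (ZMod q)ˣ × (ZMod q)ˣ × (ZMod q)ˣ × (ZMod q)ˣ,
        ZMod.stdAddChar (m * ((x.1 : ZMod q) + (x.2.1 : ZMod q) - (x.2.2.1 : ZMod q) - (x.2.2.2 : ZMod q))) *
        ZMod.stdAddChar (n * (((x.1⁻¹ : (ZMod q)ˣ) : ZMod q) + ((x.2.1⁻¹ : (ZMod q)ˣ) : ZMod q)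
      - ((x.2.2.1⁻¹ : (ZMod q)ˣ) : ZMod q) - ((x.2.2.2⁻¹ : (ZMod q)ˣ) : ZMod q))) := by
    intro m n
    have h1 : ((‖kloosterman m n‖ ^ 4 : ℝ) : ℂ) =
        kloosterman m n * (kloosterman m n * (kloosterman (-m) (-n) * kloosterman (-m) (-n))) := by
      rw [← conj_kloosterman]
      have : kloosterman m n * (starRingEnd ℂ) (kloosterman m n) = (‖kloosterman m n‖ ^ 2 : ℝ) := by
        rw [Complex.mul_conj, Complex.normSq_eq_norm_sq]
      calc ((‖kloosterman m n‖ ^ 4 : ℝ) : ℂ)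
          = ((‖kloosterman m n‖ ^ 2 : ℝ) : ℂ) * ((‖kloosterman m n‖ ^ 2 : ℝ) : ℂ) := by
            push_cast; ring
        _ = _ := by rw [← this]; ring
    rw [h1]
    simp only [kloosterman, Finset.sum_mul_sum, Fintype.sum_prod_type]
    simp only [Finset.mul_sum, ← AddChar.map_add_eq_mul]
    refine Finset.sum_congr rfl fun x _ => Finset.sum_congr rfl fun y _ =>
      Finset.sum_congr rfl fun z _ => Finset.sum_congr rfl fun w _ => ?_
    congr 1
    ring
  have hC : ((∑ m : ZMod q, ∑ n : ZMod q, ‖kloosterman m n‖ ^ 4 : ℝ) : ℂ) =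
      (((q : ℝ) ^ 2 * (unitQuadruples q).card : ℝ) : ℂ) := by
    rw [Complex.ofReal_sum]
    simp only [Complex.ofReal_sum, key]
    have : ∀ m : ZMod q, ∑ n : ZMod q,
      ∑ x : (ZMod q)ˣ × (ZMod q)ˣ × (ZMod q)ˣ × (ZMod q)ˣ,
        ZMod.stdAddChar (m * ((x.1 : ZMod q) + (x.2.1 : ZMod q) - (x.2.2.1 : ZMod q) - (x.2.2.2 : ZMod q))) *
        ZMod.stdAddChar (n * (((x.1⁻¹ : (ZMod q)ˣ) : ZMod q) + ((x.2.1⁻¹ : (ZMod q)ˣ) : ZMod q)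
      - ((x.2.2.1⁻¹ : (ZMod q)ˣ) : ZMod q) - ((x.2.2.2⁻¹ : (ZMod q)ˣ) : ZMod q)))
      = ∑ x : (ZMod q)ˣ × (ZMod q)ˣ × (ZMod q)ˣ × (ZMod q)ˣ,
        (ZMod.stdAddChar (m * ((x.1 : ZMod q) + (x.2.1 : ZMod q) - (x.2.2.1 : ZMod q) - (x.2.2.2 : ZMod q))) : ℂ) * ∑ n : ZMod q,
        ZMod.stdAddChar (n * (((x.1⁻¹ : (ZMod q)ˣ) : ZMod q) + ((x.2.1⁻¹ : (ZMod q)ˣ) : ZMod q)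
      - ((x.2.2.1⁻¹ : (ZMod q)ˣ) : ZMod q) - ((x.2.2.2⁻¹ : (ZMod q)ˣ) : ZMod q))) := by
      intro m
      rw [Finset.sum_comm]
      simp only [Finset.mul_sum]
    simp only [this]
    rw [Finset.sum_comm]
    simp only [← Finset.sum_mul, AddChar.sum_mulShift _ (ZMod.isPrimitive_stdAddChar q)]
    rw [unitQuadruples, Finset.card_filter]
    push_cast
    rw [Finset.mul_sum]
    refine Finset.sum_congr rfl fun x _ => ?_
    rw [ZMod.card]
    split_ifs <;> simp_all [sq]
  exact_mod_cast hC

theorem exists_mul_eq_gcd {q : ℕ} [NeZero q] (c : ZMod q) :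
    ∃ s : ZMod q, ((c.val.gcd q : ℕ) : ZMod q) = c * s := by
  refine ⟨((Nat.gcdA c.val q : ℤ) : ZMod q), ?_⟩
  have h := congrArg (fun z : ℤ => (z : ZMod q)) (Nat.gcd_eq_gcd_ab c.val q)
  simpa using h

theorem card_linear_solutions_le {q : ℕ} [NeZero q] (c d : ZMod q) {g : ℕ} (hg : 0 < g)
    (h : c ∣ (g : ZMod q)) :
    (Finset.univ.filter fun y : ZMod q => c * y = d).card ≤ g := by
  classical
  rcases (Finset.univ.filter fun y : ZMod q => c * y = d).eq_empty_or_nonempty with he | ⟨y₀, hy₀⟩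
  · simp [he]
  refine le_trans ?_ (IsAddCyclic.card_nsmul_eq_zero_le (α := ZMod q) hg)
  refine Finset.card_le_card_of_injOn (fun y => y - y₀) ?_ (fun a _ b _ hab => by simpa using hab)
  intro y hy
  simp only [Finset.coe_filter, Finset.mem_univ, true_and, Set.mem_ofPred_eq,
    Finset.mem_filter] at hy hy₀ ⊢
  obtain ⟨s, hs⟩ := h
  rw [nsmul_eq_mul, hs]
  linear_combination s * hy - s * hy₀

theorem sum_gcd_val_le (q : ℕ) [NeZero q] :
    ∑ c : ZMod q, c.val.gcd q ≤ q * q.divisors.card := by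
  have h0 : ∑ c : ZMod q, c.val.gcd q = ∑ k ∈ Finset.range q, k.gcd q := by
    refine Finset.sum_bij (fun c _ => c.val) (fun c _ => Finset.mem_range.2 (ZMod.val_lt c))
      (fun a _ b _ h => ZMod.val_injective q h) (fun k hk => ⟨(k : ZMod q), Finset.mem_univ _, ?_⟩)
      (fun _ _ => rfl)
    exact ZMod.val_cast_of_lt (Finset.mem_range.1 hk)
  have hq : 0 < q := Nat.pos_of_ne_zero (NeZero.ne q)
  rw [h0]
  calc ∑ k ∈ Finset.range q, k.gcd q
      ≤ ∑ k ∈ Finset.range q, ∑ d ∈ q.divisors, if d ∣ k then d else 0 := by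
        refine Finset.sum_le_sum fun k _ => ?_
        have : k.gcd q = (if k.gcd q ∣ k then k.gcd q else 0) := by
          rw [if_pos (Nat.gcd_dvd_left k q)]
        conv_lhs => rw [this]
        exact Finset.single_le_sum (f := fun d => if d ∣ k then d else 0)
          (fun _ _ => Nat.zero_le _) (Nat.mem_divisors.2 ⟨Nat.gcd_dvd_right k q, hq.ne'⟩)
    _ = ∑ d ∈ q.divisors, ∑ k ∈ Finset.range q, if d ∣ k then d else 0 := Finset.sum_comm
    _ ≤ ∑ d ∈ q.divisors, q := by
        refine Finset.sum_le_sum fun d hd => ?_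
        obtain ⟨e, he⟩ := Nat.dvd_of_mem_divisors hd
        have hd0 : 0 < d := Nat.pos_of_mem_divisors hd
        rw [← Finset.sum_filter, Finset.sum_const, smul_eq_mul]
        have : ((Finset.range q).filter (d ∣ ·)).card ≤ e := by
          rw [← Finset.card_range e]
          refine Finset.card_le_card_of_injOn (fun k => k / d) ?_ ?_
          · intro k hk
            simp only [Finset.coe_filter, Finset.mem_range, Set.mem_ofPred_eq, Finset.coe_range,
              Set.mem_Iio] at hk ⊢
            rw [Nat.div_lt_iff_lt_mul hd0, mul_comm, ← he]
            exact hk.1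
          · intro a ha b hb hab
            simp only [Finset.coe_filter, Finset.mem_range, Set.mem_ofPred_eq] at ha hb
            exact (Nat.div_left_inj ha.2 hb.2).1 hab
        calc _ ≤ e * d := Nat.mul_le_mul_right d this
          _ = q := by rw [he, mul_comm]
    _ = q * q.divisors.card := by rw [Finset.sum_const, smul_eq_mul, mul_comm]

theorem card_unitQuadruples_le (q : ℕ) [NeZero q] :
    (unitQuadruples q).card ≤ 2 * (q * q.divisors.card) ^ 2 := by
  classical
  let T : Finset (ZMod q × ZMod q × ZMod q) := Finset.univ.filter fun t =>
    (2 * t.1 * t.2.1) * t.2.2 = t.1 * t.2.1 * (t.1 + t.2.1)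
  have h1 : (unitQuadruples q).card ≤ T.card := by
    refine Finset.card_le_card_of_injOn
      (fun x => ((x.2.2.1 : ZMod q) - x.1, (x.2.2.1 : ZMod q) - x.2.1, (x.2.2.1 : ZMod q))) ?_ ?_
    · rintro ⟨x, y, z, w⟩ hx
      simp only [unitQuadruples, Finset.coe_filter, Finset.mem_univ, true_and, Set.mem_ofPred_eq,
        T] at hx ⊢
      obtain ⟨ha, hb⟩ := hx
      have hxx : (x : ZMod q) * ((x⁻¹ : (ZMod q)ˣ) : ZMod q) = 1 := Units.mul_inv x
      have hyy : (y : ZMod q) * ((y⁻¹ : (ZMod q)ˣ) : ZMod q) = 1 := Units.mul_inv y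
      have hzz : (z : ZMod q) * ((z⁻¹ : (ZMod q)ˣ) : ZMod q) = 1 := Units.mul_inv z
      have hww : (w : ZMod q) * ((w⁻¹ : (ZMod q)ˣ) : ZMod q) = 1 := Units.mul_inv w
      generalize ((x⁻¹ : (ZMod q)ˣ) : ZMod q) = x' at *
      generalize ((y⁻¹ : (ZMod q)ˣ) : ZMod q) = y' at *
      generalize ((z⁻¹ : (ZMod q)ˣ) : ZMod q) = z' at *
      generalize ((w⁻¹ : (ZMod q)ˣ) : ZMod q) = w' at *
      generalize (x : ZMod q) = X at *
      generalize (y : ZMod q) = Y at *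
      generalize (z : ZMod q) = Z at *
      generalize (w : ZMod q) = W at *
      obtain rfl : W = X + Y - Z := by linear_combination -ha
      have hb' : (X + Y) * (Z * (X + Y - Z)) - (X + Y) * (X * Y) = 0 := by
        linear_combination X * Y * Z * (X + Y - Z) * hb - Y * Z * (X + Y - Z) * hxx
          - X * Z * (X + Y - Z) * hyy + X * Y * (X + Y - Z) * hzz + X * Y * Z * hww
      linear_combination -hb'
    · rintro ⟨x, y, z, w⟩ hx ⟨x', y', z', w'⟩ hx' h
      simp only [unitQuadruples, Finset.coe_filter, Finset.mem_univ, true_and, Set.mem_ofPred_eq,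
        Prod.mk.injEq] at hx hx' h
      obtain ⟨h1, h2, h3⟩ := h
      have e1 : (x : ZMod q) = x' := by linear_combination h3 - h1
      have e2 : (y : ZMod q) = y' := by linear_combination h3 - h2
      have e4 : (w : ZMod q) = w' := by linear_combination hx'.1 - hx.1 + e1 + e2 - h3
      simp only [Prod.mk.injEq]
      exact ⟨Units.ext e1, Units.ext e2, Units.ext h3, Units.ext e4⟩
  have hpos : ∀ c : ZMod q, 0 < c.val.gcd q := fun c =>
    Nat.gcd_pos_of_pos_right _ (Nat.pos_of_ne_zero (NeZero.ne q))
  have h2 : T.card ≤ ∑ a : ZMod q, ∑ b : ZMod q, 2 * (a.val.gcd q * b.val.gcd q) := by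
    rw [Finset.card_filter, Fintype.sum_prod_type]
    refine Finset.sum_le_sum fun a _ => ?_
    rw [Fintype.sum_prod_type]
    refine Finset.sum_le_sum fun b _ => ?_
    rw [← Finset.card_filter]
    dsimp only
    refine card_linear_solutions_le (2 * a * b) (a * b * (a + b)) (Nat.mul_pos two_pos (Nat.mul_pos (hpos a) (hpos b))) ?_
    obtain ⟨s, hs⟩ := exists_mul_eq_gcd a
    obtain ⟨t, ht⟩ := exists_mul_eq_gcd b
    refine ⟨s * t, ?_⟩
    push_cast
    rw [hs, ht]
    ring
  have h3 : ∑ a : ZMod q, ∑ b : ZMod q, 2 * (a.val.gcd q * b.val.gcd q)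
      = 2 * (∑ a : ZMod q, a.val.gcd q) ^ 2 := by
    rw [sq, Finset.sum_mul_sum, Finset.mul_sum]
    simp only [Finset.mul_sum]
  calc _ ≤ _ := h1
    _ ≤ _ := h2
    _ = _ := h3
    _ ≤ _ := by gcongr; exact sum_gcd_val_le q

theorem norm_kloosterman_pow_four_le {q : ℕ} [NeZero q] (m n : ZMod q) {g : ℕ}
    (hg : g = m.val.gcd q ∨ g = n.val.gcd q) :
    ‖kloosterman m n‖ ^ 4 ≤ g * (2 * (q : ℝ) ^ 3 * (q.divisors.card : ℝ) ^ 3) := by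
  classical
  have hq : 0 < q := Nat.pos_of_ne_zero (NeZero.ne q)
  have hgpos : 0 < g := by
    rcases hg with rfl | rfl <;> exact Nat.gcd_pos_of_pos_right _ hq
  have h1 : (Nat.totient q : ℝ) * ‖kloosterman m n‖ ^ 4 ≤
      g * ∑ z : ZMod q × ZMod q, ‖kloosterman z.1 z.2‖ ^ 4 := by
    have e1 : (Nat.totient q : ℝ) * ‖kloosterman m n‖ ^ 4 =
        ∑ t : (ZMod q)ˣ, ‖kloosterman (m * (t : ZMod q)) (n * ((t⁻¹ : (ZMod q)ˣ) : ZMod q))‖ ^ 4 := by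
      simp only [kloosterman_mul_unit, Finset.sum_const, Finset.card_univ,
        ZMod.card_units_eq_totient, nsmul_eq_mul]
    rw [e1, ← Finset.sum_fiberwise Finset.univ
      (fun t : (ZMod q)ˣ => (m * (t : ZMod q), n * ((t⁻¹ : (ZMod q)ˣ) : ZMod q))), Finset.mul_sum]
    refine Finset.sum_le_sum fun z _ => ?_
    have : ∀ t ∈ Finset.univ.filter (fun t : (ZMod q)ˣ =>
        (m * (t : ZMod q), n * ((t⁻¹ : (ZMod q)ˣ) : ZMod q)) = z),
        ‖kloosterman (m * (t : ZMod q)) (n * ((t⁻¹ : (ZMod q)ˣ) : ZMod q))‖ ^ 4 =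
        ‖kloosterman z.1 z.2‖ ^ 4 := by
      intro t ht
      rw [← (Finset.mem_filter.1 ht).2]
    rw [Finset.sum_congr rfl this, Finset.sum_const, nsmul_eq_mul]
    refine mul_le_mul_of_nonneg_right ?_ (by positivity)
    norm_cast
    rcases hg with rfl | rfl
    · refine le_trans ?_ (card_linear_solutions_le m z.1 hgpos (exists_mul_eq_gcd m))
      refine Finset.card_le_card_of_injOn (fun t => (t : ZMod q)) ?_
        (fun a _ b _ hab => Units.ext hab)
      intro t ht
      simp only [Finset.coe_filter, Finset.mem_univ, true_and, Set.mem_ofPred_eq] at ht ⊢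
      rw [← ht]
    · refine le_trans ?_ (card_linear_solutions_le n z.2 hgpos (exists_mul_eq_gcd n))
      refine Finset.card_le_card_of_injOn (fun t => ((t⁻¹ : (ZMod q)ˣ) : ZMod q)) ?_
        (fun a _ b _ hab => inv_injective (Units.ext hab))
      intro t ht
      simp only [Finset.coe_filter, Finset.mem_univ, true_and, Set.mem_ofPred_eq] at ht ⊢
      rw [← ht]
  rw [Fintype.sum_prod_type, sum_norm_kloosterman_pow_four] at h1
  have h2 : ((unitQuadruples q).card : ℝ) ≤ 2 * ((q : ℝ) * q.divisors.card) ^ 2 := by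
    exact_mod_cast card_unitQuadruples_le q
  have h3 : (q : ℝ) ≤ q.divisors.card * Nat.totient q := by
    have : q ≤ q.divisors.card * Nat.totient q := by
      conv_lhs => rw [← Nat.sum_totient q]
      rw [← smul_eq_mul]
      refine Finset.sum_le_card_nsmul _ _ _ fun d hd => ?_
      exact Nat.le_of_dvd (Nat.totient_pos.2 hq)
        (Nat.totient_dvd_of_dvd (Nat.dvd_of_mem_divisors hd))
    exact_mod_cast this
  have hq' : (0 : ℝ) < q := by exact_mod_cast hq
  set d : ℝ := (q.divisors.card : ℝ)
  set S : ℝ := ‖kloosterman m n‖ ^ 4 with hS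
  have hS0 : 0 ≤ S := by positivity
  have h4 : (q : ℝ) * S ≤ q * (g * (2 * (q : ℝ) ^ 3 * d ^ 3)) := by
    calc (q : ℝ) * S ≤ d * Nat.totient q * S := by gcongr
      _ = d * (Nat.totient q * S) := by ring
      _ ≤ d * (g * ((q : ℝ) ^ 2 * (2 * (q * d) ^ 2))) := by
          have : (0 : ℝ) ≤ d := by positivity
          exact mul_le_mul_of_nonneg_left (h1.trans (by gcongr)) this
      _ = _ := by ring
  exact le_of_mul_le_mul_left h4 hq'

theorem indicator_mul_eq_sum_kloosterman {q : ℕ} [NeZero q] (u : (ZMod q)ˣ) (a b : ZMod q) :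
    (q : ℂ) ^ 2 * (if a * b = u then 1 else 0) =
      ∑ m : ZMod q, ∑ n : ZMod q, kloosterman m ((u : ZMod q) * n) *
        (ZMod.stdAddChar (-(m * a)) * ZMod.stdAddChar (-(n * b))) := by
  classical
  have h1 : ∀ m n : ZMod q, kloosterman m ((u : ZMod q) * n) *
        (ZMod.stdAddChar (-(m * a)) * ZMod.stdAddChar (-(n * b))) =
      ∑ x : (ZMod q)ˣ, (ZMod.stdAddChar (m * ((x : ZMod q) - a)) : ℂ) *
        ZMod.stdAddChar (n * ((u : ZMod q) * ((x⁻¹ : (ZMod q)ˣ) : ZMod q) - b)) := by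
    intro m n
    rw [kloosterman, Finset.sum_mul]
    refine Finset.sum_congr rfl fun x _ => ?_
    simp only [← AddChar.map_add_eq_mul]
    congr 1
    ring
  simp only [h1]
  have h2 : ∀ m : ZMod q, ∑ n : ZMod q, ∑ x : (ZMod q)ˣ,
        (ZMod.stdAddChar (m * ((x : ZMod q) - a)) : ℂ) *
        ZMod.stdAddChar (n * ((u : ZMod q) * ((x⁻¹ : (ZMod q)ˣ) : ZMod q) - b)) =
      ∑ x : (ZMod q)ˣ, (ZMod.stdAddChar (m * ((x : ZMod q) - a)) : ℂ) *
        ∑ n : ZMod q, ZMod.stdAddChar (n * ((u : ZMod q) * ((x⁻¹ : (ZMod q)ˣ) : ZMod q) - b)) := by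
    intro m
    rw [Finset.sum_comm]
    simp only [Finset.mul_sum]
  simp only [h2]
  rw [Finset.sum_comm]
  simp only [← Finset.sum_mul, AddChar.sum_mulShift _ (ZMod.isPrimitive_stdAddChar q), ZMod.card]
  by_cases hab : a * b = u
  · rw [if_pos hab]
    have hb : a * (b * ((u⁻¹ : (ZMod q)ˣ) : ZMod q)) = 1 := by
      rw [← mul_assoc, hab, Units.mul_inv]
    let x₀ : (ZMod q)ˣ := Units.mkOfMulEqOne a _ hb
    have hx₀ : (x₀ : ZMod q) = a := rfl
    have hx₀' : (u : ZMod q) * ((x₀⁻¹ : (ZMod q)ˣ) : ZMod q) = b := by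
      rw [← hab, ← hx₀, mul_comm (x₀ : ZMod q) b, mul_assoc, Units.mul_inv, mul_one]
    rw [Finset.sum_eq_single x₀]
    · rw [if_pos (by rw [hx₀, sub_self]), if_pos (by rw [hx₀', sub_self])]
      ring
    · intro x _ hx
      rw [if_neg]
      · simp
      · intro h
        exact hx (Units.ext (by rw [hx₀]; exact sub_eq_zero.1 h))
    · simp
  · rw [if_neg hab, mul_zero]
    refine (Finset.sum_eq_zero fun x _ => ?_).symm
    by_cases h : (x : ZMod q) - a = 0
    · have h' : ¬ ((u : ZMod q) * ((x⁻¹ : (ZMod q)ˣ) : ZMod q) - b = 0) := by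
        intro h'
        apply hab
        rw [← sub_eq_zero.1 h, ← sub_eq_zero.1 h', mul_left_comm, Units.mul_inv, mul_one]
      rw [if_neg h']
      simp
    · rw [if_neg h]
      simp

theorem kloosterman_zero_zero {q : ℕ} [NeZero q] :
    kloosterman (0 : ZMod q) 0 = (Nat.totient q : ℂ) := by
  simp [kloosterman, ZMod.card_units_eq_totient]

/-- The Fourier transform at `m` of the measure `∑ w i · δ (a i)` on `ZMod q`. -/
noncomputable def expSum {q : ℕ} [NeZero q] (s : Finset ℤ) (w : ℤ → ℝ) (a : ℤ → ZMod q)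
    (m : ZMod q) : ℂ :=
  ∑ i ∈ s, (w i : ℂ) * ZMod.stdAddChar (-(m * a i))

theorem norm_bilinear_sub_le {q : ℕ} [NeZero q] (u : (ZMod q)ˣ) (s t : Finset ℤ) (w v : ℤ → ℝ)
    (a b : ℤ → ZMod q) {κ : ℝ} (hκ : ∀ m n : ZMod q,
      ‖kloosterman m n‖ ≤ κ * m.val.gcd q ∧ ‖kloosterman m n‖ ≤ κ * n.val.gcd q) :
    |(q : ℝ) ^ 2 * (∑ i ∈ s, ∑ j ∈ t, if a i * b j = u then w i * v j else 0) -
      Nat.totient q * ((∑ i ∈ s, w i) * ∑ j ∈ t, v j)| ≤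
    κ * ((∑ m ∈ Finset.univ.erase (0 : ZMod q), m.val.gcd q * ‖expSum s w a m‖) *
        (∑ n : ZMod q, ‖expSum t v b n‖) +
      ‖expSum s w a 0‖ *
        ∑ n ∈ Finset.univ.erase (0 : ZMod q), n.val.gcd q * ‖expSum t v b n‖) := by
  classical
  have h1 : (q : ℂ) ^ 2 * (∑ i ∈ s, ∑ j ∈ t, if a i * b j = u then (w i : ℂ) * v j else 0) =
      ∑ m : ZMod q, ∑ n : ZMod q, kloosterman m ((u : ZMod q) * n) *
        (expSum s w a m * expSum t v b n) := by
    have : ∀ i j, (q : ℂ) ^ 2 * (if a i * b j = u then (w i : ℂ) * v j else 0) =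
        ∑ m : ZMod q, ∑ n : ZMod q, kloosterman m ((u : ZMod q) * n) *
        (((w i : ℂ) * ZMod.stdAddChar (-(m * a i))) *
          ((v j : ℂ) * ZMod.stdAddChar (-(n * b j)))) := by
      intro i j
      have h := congrArg (fun z : ℂ => z * ((w i : ℂ) * v j))
        (indicator_mul_eq_sum_kloosterman u (a i) (b j))
      simp only [Finset.sum_mul] at h
      have h0 : (q : ℂ) ^ 2 * (if a i * b j = u then (w i : ℂ) * v j else 0) =
          (q : ℂ) ^ 2 * (if a i * b j = u then 1 else 0) * ((w i : ℂ) * v j) := by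
        split_ifs <;> ring
      rw [h0, h]
      refine Finset.sum_congr rfl fun m _ => Finset.sum_congr rfl fun n _ => ?_
      ring
    simp only [Finset.mul_sum, this]
    rw [Finset.sum_congr rfl fun i _ => (Finset.sum_comm.trans
      (Finset.sum_congr rfl fun m _ => Finset.sum_comm) : _ = ∑ m : ZMod q, ∑ n : ZMod q,
        ∑ j ∈ t, kloosterman m ((u : ZMod q) * n) *
        (((w i : ℂ) * ZMod.stdAddChar (-(m * a i))) *
          ((v j : ℂ) * ZMod.stdAddChar (-(n * b j)))))]
    rw [Finset.sum_comm]
    refine Finset.sum_congr rfl fun m _ => ?_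
    rw [Finset.sum_comm]
    refine Finset.sum_congr rfl fun n _ => ?_
    rw [expSum, expSum, Finset.sum_mul_sum, Finset.mul_sum]
    simp only [Finset.mul_sum]
  have h2 : ∑ m : ZMod q, ∑ n : ZMod q, kloosterman m ((u : ZMod q) * n) *
        (expSum s w a m * expSum t v b n) =
      (∑ m ∈ Finset.univ.erase (0 : ZMod q), ∑ n : ZMod q, kloosterman m ((u : ZMod q) * n) *
        (expSum s w a m * expSum t v b n)) +
      ((∑ n ∈ Finset.univ.erase (0 : ZMod q), kloosterman 0 ((u : ZMod q) * n) *
        (expSum s w a 0 * expSum t v b n)) +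
        Nat.totient q * (expSum s w a 0 * expSum t v b 0)) := by
    rw [← Finset.sum_erase_add _ _ (Finset.mem_univ (0 : ZMod q)),
      ← Finset.sum_erase_add (f := fun n => kloosterman 0 ((u : ZMod q) * n) *
        (expSum s w a 0 * expSum t v b n)) _ (Finset.mem_univ (0 : ZMod q)),
      mul_zero, kloosterman_zero_zero]
  have h3 : (((q : ℝ) ^ 2 * (∑ i ∈ s, ∑ j ∈ t, if a i * b j = u then w i * v j else 0) -
      Nat.totient q * ((∑ i ∈ s, w i) * ∑ j ∈ t, v j) : ℝ) : ℂ) =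
      (∑ m ∈ Finset.univ.erase (0 : ZMod q), ∑ n : ZMod q, kloosterman m ((u : ZMod q) * n) *
        (expSum s w a m * expSum t v b n)) +
      (∑ n ∈ Finset.univ.erase (0 : ZMod q), kloosterman 0 ((u : ZMod q) * n) *
        (expSum s w a 0 * expSum t v b n)) := by
    have e1 : expSum s w a 0 = ∑ i ∈ s, (w i : ℂ) := by simp [expSum]
    have e2 : expSum t v b 0 = ∑ i ∈ t, (v i : ℂ) := by simp [expSum]
    have h4 := h1.trans h2
    rw [e1, e2] at h4
    have e3 : (((q : ℝ) ^ 2 * (∑ i ∈ s, ∑ j ∈ t, if a i * b j = u then w i * v j else 0) -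
      Nat.totient q * ((∑ i ∈ s, w i) * ∑ j ∈ t, v j) : ℝ) : ℂ) = (q : ℂ) ^ 2 * (∑ i ∈ s, ∑ j ∈ t,
        if a i * b j = u then (w i : ℂ) * v j else 0) -
      Nat.totient q * ((∑ i ∈ s, (w i : ℂ)) * ∑ j ∈ t, (v j : ℂ)) := by
      push_cast
      congr 2
      refine Finset.sum_congr rfl fun i _ => Finset.sum_congr rfl fun j _ => ?_
      split_ifs <;> simp
    rw [e3, h4, e1]
    ring
  have hk : ∀ m n : ZMod q, ‖kloosterman m ((u : ZMod q) * n)‖ ≤ κ * n.val.gcd q := by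
    intro m n
    have := kloosterman_mul_unit m ((u : ZMod q) * n) u
    rw [mul_comm (u : ZMod q) n, mul_assoc, Units.mul_inv, mul_one, mul_comm n] at this
    rw [← this]
    exact (hκ _ _).2
  rw [← Real.norm_eq_abs, ← Complex.norm_real, h3]
  refine (norm_add_le _ _).trans ?_
  rw [mul_add]
  refine add_le_add ?_ ?_
  · refine (norm_sum_le _ _).trans ?_
    rw [Finset.sum_mul, Finset.mul_sum]
    refine Finset.sum_le_sum fun m _ => (norm_sum_le _ _).trans ?_
    rw [Finset.mul_sum, Finset.mul_sum]
    refine Finset.sum_le_sum fun n _ => ?_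
    rw [norm_mul, norm_mul]
    calc _ ≤ κ * m.val.gcd q * (‖expSum s w a m‖ * ‖expSum t v b n‖) := by
          gcongr; exact (hκ _ _).1
      _ = _ := by ring
  · refine (norm_sum_le _ _).trans ?_
    rw [Finset.mul_sum, Finset.mul_sum]
    refine Finset.sum_le_sum fun n _ => ?_
    rw [norm_mul, norm_mul]
    calc _ ≤ κ * n.val.gcd q * (‖expSum s w a 0‖ * ‖expSum t v b n‖) := by
          gcongr; exact hk _ _
      _ = _ := by ring

theorem norm_sum_geometric_antitone_le {w : ℤ → ℝ} {z : ℤ → ℂ} {ζ : ℂ} {A B : ℤ} {W : ℝ}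
    (hz : ∀ j, z (j + 1) = z j * ζ) (hz1 : ∀ j, ‖z j‖ = 1) (hζ : ζ ≠ 1)
    (hw0 : ∀ j, A < j → 0 ≤ w j) (hwW : ∀ j, A < j → w j ≤ W)
    (hw : ∀ j, A < j → w (j + 1) ≤ w j) (hW : 0 ≤ W) :
    ‖∑ j ∈ Finset.Ioc A B, (w j : ℂ) * z j‖ ≤ 2 * W / ‖1 - ζ‖ := by
  have hpos : 0 < ‖1 - ζ‖ := norm_pos_iff.2 (sub_ne_zero.2 hζ.symm)
  rcases lt_or_ge B A with h | h
  · rw [Finset.Ioc_eq_empty (by omega)]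
    simp only [Finset.sum_empty, norm_zero]
    positivity
  have key : ∀ B, A ≤ B → ‖(1 - ζ) * (∑ j ∈ Finset.Ioc A B, (w j : ℂ) * z j) +
      w (B + 1) * z (B + 1)‖ ≤ 2 * W - w (B + 1) := by
    intro B hB
    induction B, hB using Int.leInduction with
    | base =>
      simp only [Finset.Ioc_self, Finset.sum_empty, mul_zero, zero_add, norm_mul, hz1,
        Complex.norm_real, mul_one, Real.norm_eq_abs]
      rw [abs_of_nonneg (hw0 _ (by omega))]
      linarith [hwW (A + 1) (by omega)]
    | succ B hB ih =>
      have e : Finset.Ioc A (B + 1) = insert (B + 1) (Finset.Ioc A B) := by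
        ext x; simp only [Finset.mem_Ioc, Finset.mem_insert]; omega
      rw [e, Finset.sum_insert (by simp)]
      have : (1 - ζ) * ((w (B + 1) : ℂ) * z (B + 1) + ∑ j ∈ Finset.Ioc A B, (w j : ℂ) * z j) +
          w (B + 1 + 1) * z (B + 1 + 1) =
          ((1 - ζ) * (∑ j ∈ Finset.Ioc A B, (w j : ℂ) * z j) + w (B + 1) * z (B + 1)) +
          ((w (B + 1 + 1) - w (B + 1) : ℝ) : ℂ) * z (B + 1 + 1) := by
        rw [hz (B + 1)]; push_cast; ring
      rw [this]
      refine (norm_add_le _ _).trans ?_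
      rw [norm_mul, hz1, mul_one, Complex.norm_real, Real.norm_eq_abs,
        abs_of_nonpos (by linarith [hw (B + 1) (by omega)])]
      linarith
  rw [le_div_iff₀ hpos, mul_comm, ← norm_mul]
  have h1 := key B h
  have h2 := norm_sub_le ((1 - ζ) * (∑ j ∈ Finset.Ioc A B, (w j : ℂ) * z j) +
      w (B + 1) * z (B + 1)) (w (B + 1) * z (B + 1))
  rw [add_sub_cancel_right, norm_mul (w (B + 1) : ℂ), hz1, mul_one, Complex.norm_real,
    Real.norm_eq_abs, abs_of_nonneg (hw0 _ (by omega))] at h2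
  linarith

theorem gcd_val_mul_unit {q : ℕ} [NeZero q] (c : (ZMod q)ˣ) (m : ZMod q) :
    ((c : ZMod q) * m).val.gcd q = m.val.gcd q := by
  rw [ZMod.val_mul, ← Nat.gcd_rec, Nat.gcd_comm q]
  exact Nat.Coprime.gcd_mul_left_cancel _ (ZMod.val_coe_unit_coprime c)

theorem inv_norm_one_sub_stdAddChar_le {q : ℕ} [NeZero q] {k : ℕ} (hk : 0 < k) (hkq : k < q) :
    1 / ‖1 - (ZMod.stdAddChar ((k : ZMod q)) : ℂ)‖ ≤
      (q : ℝ) / 4 * (1 / (k : ℝ) + 1 / ((q - k : ℕ) : ℝ)) := by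
  have hq : (0 : ℝ) < q := by exact_mod_cast hk.trans hkq
  have hk' : (0 : ℝ) < k := by exact_mod_cast hk
  have hqk : (0 : ℝ) < ((q - k : ℕ) : ℝ) := by exact_mod_cast Nat.sub_pos_of_lt hkq
  have hsub : ((q - k : ℕ) : ℝ) = q - k := by rw [Nat.cast_sub hkq.le]
  have hn : ‖1 - (ZMod.stdAddChar ((k : ZMod q)) : ℂ)‖ = 2 * |Real.sin (π * k / q)| := by
    have h1 : (ZMod.stdAddChar ((k : ZMod q)) : ℂ) =
        Complex.exp (Complex.I * ((2 * π * k / q : ℝ) : ℂ)) := by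
      have := ZMod.toCircle_intCast (N := q) (k : ℤ)
      rw [ZMod.stdAddChar_apply]
      push_cast at this ⊢
      rw [this]
      congr 1
      ring
    rw [h1, norm_sub_rev, Complex.norm_exp_I_mul_ofReal_sub_one, norm_mul, Real.norm_eq_abs,
      Real.norm_eq_abs, abs_of_pos (by norm_num : (0 : ℝ) < 2)]
    congr 3
    ring
  have hsin : min (k : ℝ) (q - k) * 2 / q ≤ |Real.sin (π * k / q)| := by
    refine le_trans ?_ (le_abs_self _)
    rcases le_total (k : ℝ) (q - k) with h | h
    · rw [min_eq_left h]
      have hx : π * k / q ≤ π / 2 := by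
        rw [div_le_div_iff₀ hq two_pos]; nlinarith [Real.pi_pos]
      refine le_trans (le_of_eq ?_) (Real.mul_le_sin (by positivity) hx)
      field_simp
    · rw [min_eq_right h, ← Real.sin_pi_sub]
      have e : π - π * k / q = π * (q - k) / q := by field_simp
      rw [e]
      have hx : π * (q - k) / q ≤ π / 2 := by
        rw [div_le_div_iff₀ hq two_pos]; nlinarith [Real.pi_pos]
      have h0 : (0 : ℝ) ≤ q - k := by linarith
      refine le_trans (le_of_eq ?_) (Real.mul_le_sin (by positivity) hx)
      field_simp
  have hmin : 0 < min (k : ℝ) (q - k) := lt_min hk' (by linarith)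
  rw [hn]
  calc 1 / (2 * |Real.sin (π * k / q)|) ≤ 1 / (2 * (min (k : ℝ) (q - k) * 2 / q)) := by
        gcongr
    _ = (q : ℝ) / 4 * (1 / min (k : ℝ) (q - k)) := by field_simp; norm_num
    _ ≤ _ := by
        gcongr
        have hqk' := one_div_pos.2 hqk
        rw [hsub] at hqk' ⊢
        rcases le_total (k : ℝ) (q - k) with h | h
        · rw [min_eq_left h]; linarith
        · rw [min_eq_right h]; linarith [one_div_pos.2 hk']

theorem sum_gcd_div_le (q : ℕ) (hq : 0 < q) :
    ∑ k ∈ Finset.Ico 1 q, ((k.gcd q : ℕ) : ℝ) / k ≤ q.divisors.card * (1 + Real.log q) := by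
  calc ∑ k ∈ Finset.Ico 1 q, ((k.gcd q : ℕ) : ℝ) / k
      ≤ ∑ k ∈ Finset.Ico 1 q, ∑ d ∈ q.divisors, if d ∣ k then (d : ℝ) / k else 0 := by
        refine Finset.sum_le_sum fun k _ => ?_
        have : ((k.gcd q : ℕ) : ℝ) / k =
            (if k.gcd q ∣ k then ((k.gcd q : ℕ) : ℝ) / k else 0) := by
          rw [if_pos (Nat.gcd_dvd_left k q)]
        rw [this]
        exact Finset.single_le_sum (f := fun d => if d ∣ k then (d : ℝ) / k else 0)
          (fun _ _ => by positivity) (Nat.mem_divisors.2 ⟨Nat.gcd_dvd_right k q, hq.ne'⟩)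
    _ = ∑ d ∈ q.divisors, ∑ k ∈ Finset.Ico 1 q, if d ∣ k then (d : ℝ) / k else 0 :=
        Finset.sum_comm
    _ ≤ ∑ d ∈ q.divisors, (1 + Real.log q) := by
        refine Finset.sum_le_sum fun d hd => ?_
        have hd0 : 0 < d := Nat.pos_of_mem_divisors hd
        rw [← Finset.sum_filter]
        refine le_trans ?_ (harmonic_le_one_add_log q)
        rw [harmonic_eq_sum_Icc]
        push_cast
        have hcong : ∀ k ∈ (Finset.Ico 1 q).filter (d ∣ ·),
            (d : ℝ) / k = (((k / d : ℕ) : ℝ))⁻¹ := by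
          intro k hk
          obtain ⟨e, rfl⟩ := (Finset.mem_filter.1 hk).2
          rw [Nat.mul_div_cancel_left _ hd0]
          push_cast
          have : (d : ℝ) ≠ 0 := by positivity
          rw [div_mul_eq_div_div, div_self this, one_div]
        have hinj : Set.InjOn (fun k => k / d) ((Finset.Ico 1 q).filter (d ∣ ·) : Set ℕ) := by
          intro a ha b hb hab
          rw [Finset.coe_filter] at ha hb
          exact (Nat.div_left_inj ha.2 hb.2).1 hab
        rw [Finset.sum_congr rfl hcong,
          ← Finset.sum_image (g := fun k => k / d) (f := fun i : ℕ => ((i : ℝ))⁻¹) hinj]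
        refine Finset.sum_le_sum_of_subset_of_nonneg ?_ fun _ _ _ => by positivity
        intro i hi
        obtain ⟨k, hk, rfl⟩ := Finset.mem_image.1 hi
        obtain ⟨hk1, e, rfl⟩ := Finset.mem_filter.1 hk
        rw [Nat.mul_div_cancel_left _ hd0]
        rw [Finset.mem_Ico] at hk1
        rw [Finset.mem_Icc]
        constructor
        · rcases Nat.eq_zero_or_pos e with rfl | h
          · simp at hk1
          · exact h
        · nlinarith
    _ = _ := by rw [Finset.sum_const, nsmul_eq_mul]

theorem sum_gcd_div_norm_one_sub_le (q : ℕ) [NeZero q] :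
    ∑ m ∈ Finset.univ.erase (0 : ZMod q), (m.val.gcd q : ℝ) / ‖1 - (ZMod.stdAddChar m : ℂ)‖ ≤
      q * (q.divisors.card * (1 + Real.log q)) := by
  have hq : 0 < q := Nat.pos_of_ne_zero (NeZero.ne q)
  have h0 : ∑ m ∈ Finset.univ.erase (0 : ZMod q),
      (m.val.gcd q : ℝ) / ‖1 - (ZMod.stdAddChar m : ℂ)‖ =
      ∑ k ∈ Finset.Ico 1 q, (k.gcd q : ℝ) / ‖1 - (ZMod.stdAddChar (k : ZMod q) : ℂ)‖ := by
    refine Finset.sum_bij (fun c _ => c.val) ?_ (fun a _ b _ h => ZMod.val_injective q h) ?_ ?_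
    · intro c hc
      rw [Finset.mem_Ico]
      refine ⟨?_, ZMod.val_lt c⟩
      rw [Nat.one_le_iff_ne_zero, Ne, ZMod.val_eq_zero]
      exact Finset.ne_of_mem_erase hc
    · intro k hk
      rw [Finset.mem_Ico] at hk
      refine ⟨(k : ZMod q), ?_, ZMod.val_cast_of_lt hk.2⟩
      rw [Finset.mem_erase]
      refine ⟨fun h => ?_, Finset.mem_univ _⟩
      have h1 := ZMod.val_cast_of_lt hk.2
      rw [h, ZMod.val_zero] at h1
      omega
    · intro c _
      rw [ZMod.natCast_zmod_val]
  have hrefl : ∑ k ∈ Finset.Ico 1 q, ((k.gcd q : ℕ) : ℝ) / ((q - k : ℕ) : ℝ) =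
      ∑ k ∈ Finset.Ico 1 q, ((k.gcd q : ℕ) : ℝ) / k := by
    refine Finset.sum_nbij' (fun k => q - k) (fun k => q - k) ?_ ?_ ?_ ?_ ?_
    · intro k hk; rw [Finset.mem_Ico] at hk ⊢; omega
    · intro k hk; rw [Finset.mem_Ico] at hk ⊢; omega
    · intro k hk; rw [Finset.mem_Ico] at hk; omega
    · intro k hk; rw [Finset.mem_Ico] at hk; omega
    · intro k hk
      rw [Finset.mem_Ico] at hk
      rw [Nat.gcd_comm (q - k), Nat.gcd_self_sub_right hk.2.le, Nat.gcd_comm]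
  have hlog : 0 ≤ Real.log q := Real.log_natCast_nonneg q
  rw [h0]
  calc _ ≤ ∑ k ∈ Finset.Ico 1 q, (q : ℝ) / 4 *
        (((k.gcd q : ℕ) : ℝ) / k + ((k.gcd q : ℕ) : ℝ) / ((q - k : ℕ) : ℝ)) := by
        refine Finset.sum_le_sum fun k hk => ?_
        rw [Finset.mem_Ico] at hk
        have := mul_le_mul_of_nonneg_left (inv_norm_one_sub_stdAddChar_le (q := q) hk.1 hk.2)
          (Nat.cast_nonneg (α := ℝ) (k.gcd q))
        calc _ = (k.gcd q : ℝ) * (1 / ‖1 - (ZMod.stdAddChar (k : ZMod q) : ℂ)‖) := by ring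
          _ ≤ _ := this
          _ = _ := by ring
    _ = (q : ℝ) / 2 * ∑ k ∈ Finset.Ico 1 q, ((k.gcd q : ℕ) : ℝ) / k := by
        rw [← Finset.mul_sum, Finset.sum_add_distrib, hrefl]; ring
    _ ≤ (q : ℝ) / 2 * (q.divisors.card * (1 + Real.log q)) := by
        gcongr; exact sum_gcd_div_le q hq
    _ ≤ _ := by
        gcongr
        linarith [Nat.cast_nonneg (α := ℝ) q]

theorem sum_gcd_expSum_le {q : ℕ} [NeZero q] (c : (ZMod q)ˣ) {w : ℤ → ℝ} {A B : ℤ} {W : ℝ}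
    (hw0 : ∀ j, A < j → 0 ≤ w j) (hwW : ∀ j, A < j → w j ≤ W)
    (hw : ∀ j, A < j → w (j + 1) ≤ w j) (hW : 0 ≤ W) :
    ∑ m ∈ Finset.univ.erase (0 : ZMod q), m.val.gcd q *
      ‖expSum (Finset.Ioc A B) w (fun j => (c : ZMod q) * (j : ZMod q)) m‖ ≤
      2 * W * (q * (q.divisors.card * (1 + Real.log q))) := by
  have h1 : ∀ m ∈ Finset.univ.erase (0 : ZMod q), (m.val.gcd q : ℝ) *
      ‖expSum (Finset.Ioc A B) w (fun j => (c : ZMod q) * (j : ZMod q)) m‖ ≤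
      2 * W * (((((-c : (ZMod q)ˣ) : ZMod q) * m).val.gcd q : ℝ) /
        ‖1 - (ZMod.stdAddChar (((-c : (ZMod q)ˣ) : ZMod q) * m) : ℂ)‖) := by
    intro m hm
    rw [gcd_val_mul_unit]
    have : ‖expSum (Finset.Ioc A B) w (fun j => (c : ZMod q) * (j : ZMod q)) m‖ ≤
        2 * W / ‖1 - (ZMod.stdAddChar (((-c : (ZMod q)ˣ) : ZMod q) * m) : ℂ)‖ := by
      refine norm_sum_geometric_antitone_le ?_ (fun j => AddChar.norm_apply _ _) ?_ hw0 hwW hw hW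
      · intro j
        rw [← AddChar.map_add_eq_mul]
        congr 1
        push_cast
        ring
      · intro h
        rw [← AddChar.map_zero_eq_one (ZMod.stdAddChar (N := q))] at h
        have := ZMod.injective_stdAddChar h
        rw [Units.mul_right_eq_zero] at this
        exact Finset.ne_of_mem_erase hm this
    calc _ ≤ _ := mul_le_mul_of_nonneg_left this (Nat.cast_nonneg _)
      _ = _ := by ring
  refine (Finset.sum_le_sum h1).trans ?_
  rw [← Finset.mul_sum]
  refine mul_le_mul_of_nonneg_left ?_ (by positivity)
  refine le_trans (le_of_eq ?_) (sum_gcd_div_norm_one_sub_le q)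
  refine Finset.sum_bij (fun m _ => ((-c : (ZMod q)ˣ) : ZMod q) * m) ?_ ?_ ?_ (fun _ _ => rfl)
  · intro m hm
    rw [Finset.mem_erase, Ne, Units.mul_right_eq_zero]
    exact ⟨Finset.ne_of_mem_erase hm, Finset.mem_univ _⟩
  · intro a _ b _ h
    exact (Units.mul_right_inj _).1 h
  · intro m hm
    refine ⟨(((-c)⁻¹ : (ZMod q)ˣ) : ZMod q) * m, ?_, Units.mul_inv_cancel_left _ _⟩
    rw [Finset.mem_erase, Ne, Units.mul_right_eq_zero]
    exact ⟨Finset.ne_of_mem_erase hm, Finset.mem_univ _⟩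

theorem exists_card_divisors_le_rpow {ε : ℝ} (hε : 0 < ε) :
    ∃ C : ℝ, 1 ≤ C ∧ ∀ n : ℕ, 0 < n → (n.divisors.card : ℝ) ≤ C * (n : ℝ) ^ ε := by
  obtain ⟨P, hP⟩ := exists_nat_ge ((2 : ℝ) ^ (1 / ε))
  set M : ℝ := max 1 (1 / (ε * Real.log 2)) with hM
  have hM1 : 1 ≤ M := le_max_left _ _
  have hl2 : 0 < ε * Real.log 2 := mul_pos hε (Real.log_pos one_lt_two)
  refine ⟨M ^ P, one_le_pow₀ hM1, fun n hn => ?_⟩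
  have hfac : ∀ p ∈ n.primeFactors, ((n.factorization p + 1 : ℕ) : ℝ) ≤
      (if p < P then M else 1) * ((p : ℝ) ^ (n.factorization p)) ^ ε := by
    intro p hp
    have hp2 : (2 : ℝ) ≤ p := by exact_mod_cast (Nat.prime_of_mem_primeFactors hp).two_le
    set k := n.factorization p
    have e1 : ((p : ℝ) ^ k) ^ ε = ((p : ℝ) ^ ε) ^ k := by
      rw [← Real.rpow_natCast, ← Real.rpow_natCast, ← Real.rpow_mul (by linarith),
        ← Real.rpow_mul (by linarith), mul_comm]
    rw [e1]
    split_ifs with h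
    · have h1 : 1 + k * (ε * Real.log 2) ≤ ((p : ℝ) ^ ε) ^ k := by
        calc 1 + k * (ε * Real.log 2) ≤ Real.exp (k * (ε * Real.log 2)) := by
              linarith [Real.add_one_le_exp (k * (ε * Real.log 2))]
          _ = ((2 : ℝ) ^ ε) ^ k := by
              rw [Real.rpow_def_of_pos two_pos, ← Real.exp_nat_mul]; ring_nf
          _ ≤ _ := by gcongr
      have h2 : 1 ≤ M * (ε * Real.log 2) := by
        calc 1 = 1 / (ε * Real.log 2) * (ε * Real.log 2) := by field_simp
          _ ≤ _ := by gcongr; exact le_max_right _ _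
      push_cast
      calc (k : ℝ) + 1 ≤ k * (M * (ε * Real.log 2)) + M := by
            nlinarith [Nat.cast_nonneg (α := ℝ) k]
        _ = M * (1 + k * (ε * Real.log 2)) := by ring
        _ ≤ _ := by gcongr
    · rw [one_mul]
      have h1 : (2 : ℝ) ≤ (p : ℝ) ^ ε := by
        have : (2 : ℝ) ^ (1 / ε) ≤ p := hP.trans (by exact_mod_cast not_lt.1 h)
        calc (2 : ℝ) = ((2 : ℝ) ^ (1 / ε)) ^ ε := by
              rw [← Real.rpow_mul two_pos.le, one_div_mul_cancel hε.ne', Real.rpow_one]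
          _ ≤ _ := by gcongr
      calc ((k + 1 : ℕ) : ℝ) ≤ (2 : ℝ) ^ k := by exact_mod_cast Nat.lt_two_pow_self
        _ ≤ _ := by gcongr
  rw [Nat.card_divisors hn.ne']
  push_cast
  have hn' : (n : ℝ) ^ ε = ∏ p ∈ n.primeFactors, ((p : ℝ) ^ (n.factorization p)) ^ ε := by
    conv_lhs => rw [← Nat.prod_factorization_pow_eq_self hn.ne']
    rw [Finsupp.prod, Nat.support_factorization]
    push_cast
    rw [Real.finsetProd_rpow _ _ fun _ _ => by positivity]
  calc _ ≤ ∏ p ∈ n.primeFactors, (if p < P then M else 1) * ((p : ℝ) ^ (n.factorization p)) ^ ε :=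
        Finset.prod_le_prod (fun _ _ => by positivity) fun p hp => by
          have := hfac p hp
          push_cast at this
          exact this
    _ = (∏ p ∈ n.primeFactors, if p < P then M else 1) * (n : ℝ) ^ ε := by
        rw [Finset.prod_mul_distrib, hn']
    _ ≤ _ := by
        gcongr
        rw [← Finset.prod_filter, Finset.prod_const]
        refine pow_le_pow_right₀ hM1 ?_
        refine (Finset.card_le_card (t := Finset.range P) fun p hp => ?_).trans_eq
          (Finset.card_range P)
        exact Finset.mem_range.2 (Finset.mem_filter.1 hp).2

theorem abs_modular_hyperbola_sub_le {q : ℕ} [NeZero q] (u c : (ZMod q)ˣ) {w v : ℤ → ℝ}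
    {A B A' B' : ℤ} {W V : ℝ}
    (hw0 : ∀ j, A < j → 0 ≤ w j) (hwW : ∀ j, A < j → w j ≤ W)
    (hw : ∀ j, A < j → w (j + 1) ≤ w j) (hW : 0 ≤ W)
    (hv0 : ∀ j, A' < j → 0 ≤ v j) (hvV : ∀ j, A' < j → v j ≤ V)
    (hv : ∀ j, A' < j → v (j + 1) ≤ v j) (hV : 0 ≤ V)
    (hAB : B - A ≤ 2 * q) (hAB' : B' - A' ≤ 2 * q) :
    |(∑ i ∈ Finset.Ioc A B, ∑ j ∈ Finset.Ioc A' B',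
        if (c : ZMod q) * (i : ZMod q) * (j : ZMod q) = u then w i * v j else 0) -
      Nat.totient q / (q : ℝ) ^ 2 * ((∑ i ∈ Finset.Ioc A B, w i) * ∑ j ∈ Finset.Ioc A' B', v j)| ≤
    12 * (2 * (q : ℝ) ^ 3 * (q.divisors.card : ℝ) ^ 3) ^ (1 / 4 : ℝ) * (W * V) *
      (q.divisors.card * (1 + Real.log q)) ^ 2 := by
  set κ : ℝ := (2 * (q : ℝ) ^ 3 * (q.divisors.card : ℝ) ^ 3) ^ (1 / 4 : ℝ) with hκdef
  set D : ℝ := q.divisors.card * (1 + Real.log q) with hD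
  have hq : 0 < q := Nat.pos_of_ne_zero (NeZero.ne q)
  have hq' : (0 : ℝ) < q := by exact_mod_cast hq
  have hκ0 : 0 ≤ κ := by positivity
  have hD1 : 1 ≤ D := by
    have h1 : (1 : ℝ) ≤ q.divisors.card := by
      exact_mod_cast Finset.card_pos.2 ⟨1, Nat.one_mem_divisors.2 hq.ne'⟩
    have h2 := Real.log_natCast_nonneg q
    nlinarith
  have hκ4 : κ ^ 4 = 2 * (q : ℝ) ^ 3 * (q.divisors.card : ℝ) ^ 3 := by
    rw [hκdef, ← Real.rpow_natCast, ← Real.rpow_mul (by positivity)]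
    norm_num
  have hk : ∀ (m n : ZMod q) (g : ℕ), (g = m.val.gcd q ∨ g = n.val.gcd q) →
      ‖kloosterman m n‖ ≤ κ * g := by
    intro m n g hg
    refine le_of_pow_le_pow_left₀ four_ne_zero (by positivity) ?_
    refine (norm_kloosterman_pow_four_le m n hg).trans ?_
    have hg1 : (1 : ℝ) ≤ g := by
      have : 0 < g := by rcases hg with rfl | rfl <;> exact Nat.gcd_pos_of_pos_right _ hq
      exact_mod_cast this
    rw [← hκ4, mul_pow, mul_comm]
    gcongr
    exact le_self_pow₀ hg1 four_ne_zero
  have hmain := norm_bilinear_sub_le u (Finset.Ioc A B) (Finset.Ioc A' B') w v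
    (fun j => (c : ZMod q) * (j : ZMod q)) (fun j => ((1 : (ZMod q)ˣ) : ZMod q) * (j : ZMod q))
    (κ := κ) fun m n => ⟨hk m n _ (Or.inl rfl), hk m n _ (Or.inr rfl)⟩
  have hF := sum_gcd_expSum_le c (A := A) (B := B) hw0 hwW hw hW
  have hG := sum_gcd_expSum_le (1 : (ZMod q)ˣ) (A := A') (B := B') hv0 hvV hv hV
  have hzero : ∀ (w : ℤ → ℝ) (A B : ℤ) (W : ℝ) (a : ℤ → ZMod q), (∀ j, A < j → 0 ≤ w j) →
      (∀ j, A < j → w j ≤ W) → 0 ≤ W → B - A ≤ 2 * q →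
      ‖expSum (Finset.Ioc A B) w a 0‖ ≤ 2 * q * W := by
    intro w A B W a h0 h1 hW h2
    refine (norm_sum_le _ _).trans ?_
    refine (Finset.sum_le_card_nsmul _ _ W ?_).trans ?_
    · intro j hj
      have hj := (Finset.mem_Ioc.1 hj).1
      rw [norm_mul, AddChar.norm_apply, mul_one, Complex.norm_real, Real.norm_eq_abs,
        abs_of_nonneg (h0 j hj)]
      exact h1 j hj
    · rw [nsmul_eq_mul, Int.card_Ioc]
      gcongr
      have : ((B - A).toNat : ℤ) ≤ 2 * q := by omega
      exact_mod_cast this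
  have hF0 := hzero w A B W (fun j => (c : ZMod q) * (j : ZMod q)) hw0 hwW hW hAB
  have hG0 := hzero v A' B' V (fun j => ((1 : (ZMod q)ˣ) : ZMod q) * (j : ZMod q)) hv0 hvV hV hAB'
  simp only [Units.val_one, one_mul] at hmain hG hG0
  rw [← hD] at hF hG
  have hGall : ∑ n : ZMod q, ‖expSum (Finset.Ioc A' B') v (fun j => (j : ZMod q)) n‖ ≤
      4 * V * (q * D) := by
    rw [← Finset.sum_erase_add _ _ (Finset.mem_univ (0 : ZMod q))]
    have h1 : ∑ n ∈ Finset.univ.erase (0 : ZMod q),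
        ‖expSum (Finset.Ioc A' B') v (fun j => (j : ZMod q)) n‖ ≤ 2 * V * (q * D) := by
      refine le_trans (Finset.sum_le_sum fun n _ => ?_) hG
      refine le_mul_of_one_le_left (norm_nonneg _) ?_
      exact_mod_cast Nat.gcd_pos_of_pos_right n.val hq
    have h2 : 2 * q * V ≤ 2 * V * (q * D) := by
      have : 0 ≤ 2 * V * q := by positivity
      nlinarith
    linarith
  have htot : |(q : ℝ) ^ 2 * (∑ i ∈ Finset.Ioc A B, ∑ j ∈ Finset.Ioc A' B',
        if (c : ZMod q) * (i : ZMod q) * (j : ZMod q) = u then w i * v j else 0) -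
      Nat.totient q * ((∑ i ∈ Finset.Ioc A B, w i) * ∑ j ∈ Finset.Ioc A' B', v j)| ≤
      (q : ℝ) ^ 2 * (12 * κ * (W * V) * D ^ 2) := by
    refine hmain.trans ?_
    calc _ ≤ κ * ((2 * W * (q * D)) * (4 * V * (q * D)) + (2 * q * W) * (2 * V * (q * D))) := by
          gcongr
      _ = (q : ℝ) ^ 2 * κ * (W * V) * (8 * D ^ 2 + 4 * D) := by ring
      _ ≤ (q : ℝ) ^ 2 * κ * (W * V) * (12 * D ^ 2) := by
          gcongr
          nlinarith
      _ = _ := by ring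
  have hq2 : (0 : ℝ) < (q : ℝ) ^ 2 := by positivity
  refine le_of_mul_le_mul_left ?_ hq2
  refine le_trans (le_of_eq ?_) htot
  rw [← abs_of_pos hq2, ← abs_mul, abs_of_pos hq2]
  congr 1
  field_simp

theorem exists_abs_modular_hyperbola_sub_le : ∃ C : ℝ, 0 < C ∧ ∀ (Q q : ℕ) [NeZero q], q ≤ Q →
    ∀ (u c : (ZMod q)ˣ) {w v : ℤ → ℝ} {A B A' B' : ℤ} {W V : ℝ},
    (∀ j, A < j → 0 ≤ w j) → (∀ j, A < j → w j ≤ W) → (∀ j, A < j → w (j + 1) ≤ w j) → 0 ≤ W →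
    (∀ j, A' < j → 0 ≤ v j) → (∀ j, A' < j → v j ≤ V) → (∀ j, A' < j → v (j + 1) ≤ v j) →
    0 ≤ V → B - A ≤ 2 * q → B' - A' ≤ 2 * q →
    |(∑ i ∈ Finset.Ioc A B, ∑ j ∈ Finset.Ioc A' B',
        if (c : ZMod q) * (i : ZMod q) * (j : ZMod q) = u then w i * v j else 0) -
      Nat.totient q / (q : ℝ) ^ 2 * ((∑ i ∈ Finset.Ioc A B, w i) * ∑ j ∈ Finset.Ioc A' B', v j)| ≤
    C * (W * V) * (Q : ℝ) ^ (5 / 6 : ℝ) := by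
  obtain ⟨C, hC1, hC⟩ := exists_card_divisors_le_rpow (ε := 1 / 60) (by norm_num)
  refine ⟨12 * (2 * C ^ 3) ^ (1 / 4 : ℝ) * (C * 61) ^ 2, by positivity, ?_⟩
  intro Q q _ hqQ u c w v A B A' B' W V h1 h2 h3 h4 h5 h6 h7 h8 h9 h10
  refine (abs_modular_hyperbola_sub_le u c h1 h2 h3 h4 h5 h6 h7 h8 h9 h10).trans ?_
  have hq : 0 < q := Nat.pos_of_ne_zero (NeZero.ne q)
  have hQ1 : (1 : ℝ) ≤ Q := by exact_mod_cast hq.trans_le hqQ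
  have hQ0 : (0 : ℝ) < Q := by linarith
  have hqQ' : (q : ℝ) ≤ Q := by exact_mod_cast hqQ
  have hd : (q.divisors.card : ℝ) ≤ C * (Q : ℝ) ^ (1 / 60 : ℝ) :=
    (hC q hq).trans (by gcongr)
  have hlog : 1 + Real.log q ≤ 61 * (Q : ℝ) ^ (1 / 60 : ℝ) := by
    have e1 := Real.log_le_rpow_div (Nat.cast_nonneg (α := ℝ) q) (by norm_num : (0 : ℝ) < 1 / 60)
    have e2 : (q : ℝ) ^ (1 / 60 : ℝ) ≤ (Q : ℝ) ^ (1 / 60 : ℝ) := by gcongr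
    have e3 : 1 ≤ (Q : ℝ) ^ (1 / 60 : ℝ) := Real.one_le_rpow hQ1 (by norm_num)
    linarith
  have hlog0 : 0 ≤ 1 + Real.log q := by linarith [Real.log_natCast_nonneg q]
  calc _ ≤ 12 * (2 * (Q : ℝ) ^ 3 * (C * (Q : ℝ) ^ (1 / 60 : ℝ)) ^ 3) ^ (1 / 4 : ℝ) * (W * V) *
        ((C * (Q : ℝ) ^ (1 / 60 : ℝ)) * (61 * (Q : ℝ) ^ (1 / 60 : ℝ))) ^ 2 := by
        gcongr
    _ = 12 * (2 * C ^ 3) ^ (1 / 4 : ℝ) * (C * 61) ^ 2 * (W * V) *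
        ((Q : ℝ) ^ 3 * ((Q : ℝ) ^ (1 / 60 : ℝ)) ^ 3) ^ (1 / 4 : ℝ) *
          ((Q : ℝ) ^ (1 / 60 : ℝ)) ^ 4 := by
        have : (2 * (Q : ℝ) ^ 3 * (C * (Q : ℝ) ^ (1 / 60 : ℝ)) ^ 3) =
          (2 * C ^ 3) * ((Q : ℝ) ^ 3 * ((Q : ℝ) ^ (1 / 60 : ℝ)) ^ 3) := by ring
        rw [this, Real.mul_rpow (by positivity) (by positivity)]
        ring
    _ ≤ 12 * (2 * C ^ 3) ^ (1 / 4 : ℝ) * (C * 61) ^ 2 * (W * V) * (Q : ℝ) ^ (5 / 6 : ℝ) := by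
        rw [mul_assoc]
        gcongr
        rw [← Real.rpow_natCast ((Q : ℝ) ^ (1 / 60 : ℝ)) 3,
          ← Real.rpow_natCast ((Q : ℝ) ^ (1 / 60 : ℝ)) 4, ← Real.rpow_natCast (Q : ℝ) 3,
          ← Real.rpow_mul hQ0.le, ← Real.rpow_mul hQ0.le, ← Real.rpow_add hQ0,
          ← Real.rpow_mul hQ0.le, ← Real.rpow_add hQ0]
        exact Real.rpow_le_rpow_of_exponent_le hQ1 (by norm_num)

theorem abs_riemann_sum_sub_integral_le {h : ℝ → ℝ} {K M : ℝ}
    (hK : ∀ x y, |h x - h y| ≤ K * |x - y|) (hM : ∀ x, |h x| ≤ M) {η : ℝ} (hη : 0 < η) (ρ : ℝ)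
    {α β : ℝ} (hαβ : α ≤ β) :
    |η * (∑ j ∈ Finset.Ioc ⌊(α - ρ) / η⌋ ⌊(β - ρ) / η⌋, h (ρ + η * j)) - ∫ x in α..β, h x| ≤
      η * (K * (β - α + η) + 2 * M) := by
  have hK0 : 0 ≤ K := by
    have := (abs_nonneg _).trans (hK 1 0)
    simpa using this
  have hcont : Continuous h := by
    have : LipschitzWith (Real.toNNReal K) h := LipschitzWith.of_dist_le_mul fun x y => by
      rw [Real.dist_eq, Real.dist_eq, Real.coe_toNNReal _ hK0]
      exact hK x y
    exact this.continuous
  have h_intble : ∀ a b, IntervalIntegrable h volume a b := fun a b => hcont.intervalIntegrable a b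
  have hbound : ∀ a b : ℝ, |∫ x in a..b, h x| ≤ M * |b - a| := fun a b => by
    have := intervalIntegral.norm_integral_le_of_norm_le_const (f := h) (a := a) (b := b) (C := M)
      fun x _ => hM x
    simpa using this
  set A := ⌊(α - ρ) / η⌋ with hA
  have key : ∀ B, A ≤ B → |η * (∑ j ∈ Finset.Ioc A B, h (ρ + η * j)) -
      ∫ x in (ρ + η * A)..(ρ + η * B), h x| ≤ K * η ^ 2 * (B - A) := by
    intro B hB
    induction B, hB using Int.leInduction with
    | base => simp
    | succ B hB ih =>
      have e : Finset.Ioc A (B + 1) = insert (B + 1) (Finset.Ioc A B) := by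
        ext x; simp only [Finset.mem_Ioc, Finset.mem_insert]; omega
      rw [e, Finset.sum_insert (by simp),
        ← intervalIntegral.integral_add_adjacent_intervals (h_intble (ρ + η * A) (ρ + η * B))
          (h_intble (ρ + η * B) (ρ + η * (B + 1 : ℤ)))]
      have h1 : |∫ x in (ρ + η * B)..(ρ + η * (B + 1 : ℤ)), (h (ρ + η * (B + 1 : ℤ)) - h x)| ≤
          K * η * η := by
        have := intervalIntegral.norm_integral_le_of_norm_le_const (a := ρ + η * B)
          (b := ρ + η * (B + 1 : ℤ)) (f := fun x => h (ρ + η * (B + 1 : ℤ)) - h x) (C := K * η) ?_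
        · refine this.trans (le_of_eq ?_)
          push_cast
          rw [show ρ + η * ((B : ℝ) + 1) - (ρ + η * B) = η by ring, abs_of_pos hη]
        · intro x hx
          rw [Set.uIoc_of_le (by push_cast; nlinarith)] at hx
          refine (hK _ _).trans ?_
          gcongr
          push_cast at hx ⊢
          rw [abs_le]
          constructor <;> nlinarith [hx.1, hx.2]
      rw [intervalIntegral.integral_sub (by simp) (h_intble _ _),
        intervalIntegral.integral_const] at h1
      rw [smul_eq_mul, show (ρ + η * ((B + 1 : ℤ) : ℝ) - (ρ + η * B)) = η by push_cast; ring] at h1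
      have h2 : η * (h (ρ + η * (B + 1 : ℤ)) + ∑ j ∈ Finset.Ioc A B, h (ρ + η * j)) -
          ((∫ x in (ρ + η * A)..(ρ + η * B), h x) +
            ∫ x in (ρ + η * B)..(ρ + η * (B + 1 : ℤ)), h x) =
          (η * (∑ j ∈ Finset.Ioc A B, h (ρ + η * j)) -
            ∫ x in (ρ + η * A)..(ρ + η * B), h x) +
          (η * h (ρ + η * (B + 1 : ℤ)) - ∫ x in (ρ + η * B)..(ρ + η * (B + 1 : ℤ)), h x) := by
        ring
      rw [h2]
      refine (abs_add_le _ _).trans ((add_le_add ih h1).trans (le_of_eq ?_))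
      push_cast
      ring
  set B := ⌊(β - ρ) / η⌋ with hB
  have hAB : A ≤ B := Int.floor_le_floor (by gcongr)
  have a1 : ρ + η * A ≤ α := by
    have := Int.floor_le ((α - ρ) / η)
    rw [le_div_iff₀ hη] at this; linarith
  have a2 : α < ρ + η * A + η := by
    have := Int.lt_floor_add_one ((α - ρ) / η)
    rw [div_lt_iff₀ hη] at this; linarith
  have b1 : ρ + η * B ≤ β := by
    have := Int.floor_le ((β - ρ) / η)
    rw [le_div_iff₀ hη] at this; linarith
  have b2 : β < ρ + η * B + η := by
    have := Int.lt_floor_add_one ((β - ρ) / η)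
    rw [div_lt_iff₀ hη] at this; linarith
  have hM0 : 0 ≤ M := (abs_nonneg _).trans (hM 0)
  have e1 : ∫ x in α..β, h x = (∫ x in (ρ + η * A)..(ρ + η * B), h x) -
      (∫ x in (ρ + η * A)..α, h x) + ∫ x in (ρ + η * B)..β, h x := by
    rw [← intervalIntegral.integral_add_adjacent_intervals (h_intble (ρ + η * A) α)
      (h_intble α (ρ + η * B)), ← intervalIntegral.integral_add_adjacent_intervals
      (h_intble α (ρ + η * B)) (h_intble (ρ + η * B) β)]
    ring
  have h1 := key B hAB
  have h2 := hbound (ρ + η * A) α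
  have h3 := hbound (ρ + η * B) β
  rw [abs_of_nonneg (show (0:ℝ) ≤ α - (ρ + η * A) by linarith)] at h2
  rw [abs_of_nonneg (show (0:ℝ) ≤ β - (ρ + η * B) by linarith)] at h3
  have h2' : M * (α - (ρ + η * A)) ≤ M * η := by gcongr; linarith
  have h3' : M * (β - (ρ + η * B)) ≤ M * η := by gcongr; linarith
  have h4 : K * η ^ 2 * (B - A) ≤ K * η * (β - α + η) := by
    have : η * (B - A) ≤ β - α + η := by linarith
    calc K * η ^ 2 * (B - A) = K * η * (η * (B - A)) := by ring
      _ ≤ _ := by gcongr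
  rw [e1]
  rw [abs_le] at *
  constructor <;> nlinarith

theorem sum_totient_inversion {n : ℕ} (hn : 0 < n) :
    (Nat.totient n : ℝ) / n = ∑ d ∈ n.divisors, (ArithmeticFunction.moebius d : ℝ) / d := by
  have h := (ArithmeticFunction.sum_eq_iff_sum_mul_moebius_eq
    (f := fun n => (Nat.totient n : ℝ)) (g := fun n => (n : ℝ))).1
    (fun n _ => by exact_mod_cast Nat.sum_totient n) n hn
  rw [← h, Nat.sum_divisorsAntidiagonal (f := fun x y => (ArithmeticFunction.moebius x : ℝ) * y),
    Finset.sum_div]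
  refine Finset.sum_congr rfl fun d hd => ?_
  obtain ⟨e, rfl⟩ := Nat.dvd_of_mem_divisors hd
  have hd0 := Nat.pos_of_mem_divisors hd
  have he0 : 0 < e := Nat.pos_of_mul_pos_left hn
  rw [Nat.mul_div_cancel_left _ hd0]
  push_cast
  field_simp

theorem coprime_totient_div_eq {L Q q : ℕ} (hL : 0 < L) (hq : 0 < q) (hqQ : q ≤ Q) :
    (if q.Coprime L then (Nat.totient q : ℝ) / q else 0) =
      ∑ e ∈ L.divisors, ∑ d ∈ (Finset.Icc 1 Q).filter (Nat.Coprime L),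
        if d * e ∣ q then (ArithmeticFunction.moebius e : ℝ) *
          ((ArithmeticFunction.moebius d : ℝ) / d) else 0 := by
  have h1 : ∀ e ∈ L.divisors, ∀ d ∈ (Finset.Icc 1 Q).filter (Nat.Coprime L),
      (if d * e ∣ q then (ArithmeticFunction.moebius e : ℝ) *
          ((ArithmeticFunction.moebius d : ℝ) / d) else 0) =
      (if e ∣ q then (ArithmeticFunction.moebius e : ℝ) else 0) *
        (if d ∣ q then (ArithmeticFunction.moebius d : ℝ) / d else 0) := by
    intro e he d hd
    have hco : d.Coprime e := (Nat.Coprime.coprime_dvd_left (Nat.dvd_of_mem_divisors he)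
      (Finset.mem_filter.1 hd).2).symm
    have : d * e ∣ q ↔ e ∣ q ∧ d ∣ q :=
      ⟨fun h => ⟨(Dvd.intro_left _ rfl).trans h, (Dvd.intro _ rfl).trans h⟩,
        fun h => hco.mul_dvd_of_dvd_of_dvd h.2 h.1⟩
    by_cases ha : e ∣ q <;> by_cases hb : d ∣ q <;> simp [this, ha, hb]
  rw [Finset.sum_congr rfl fun e he => Finset.sum_congr rfl fun d hd => h1 e he d hd]
  simp only [← Finset.mul_sum, ← Finset.sum_mul]
  have h2 : ∑ e ∈ L.divisors, (if e ∣ q then (ArithmeticFunction.moebius e : ℝ) else 0) =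
      if q.Coprime L then 1 else 0 := by
    rw [← Finset.sum_filter]
    have : L.divisors.filter (· ∣ q) = (Nat.gcd q L).divisors := by
      ext e
      simp only [Finset.mem_filter, Nat.mem_divisors, Nat.dvd_gcd_iff]
      have : Nat.gcd q L ≠ 0 := (Nat.gcd_pos_of_pos_left _ hq).ne'
      have := hL.ne'
      tauto
    rw [this]
    have h3 := DFunLike.congr_fun ArithmeticFunction.moebius_mul_coe_zeta (Nat.gcd q L)
    rw [ArithmeticFunction.coe_mul_zeta_apply, ArithmeticFunction.one_apply] at h3
    exact_mod_cast h3
  rw [h2]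
  split_ifs with hco
  · rw [one_mul, sum_totient_inversion hq, ← Finset.sum_filter]
    refine Finset.sum_congr ?_ fun _ _ => rfl
    ext d
    simp only [Finset.mem_filter, Nat.mem_divisors, Finset.mem_Icc]
    constructor
    · rintro ⟨h, _⟩
      exact ⟨⟨⟨Nat.pos_of_dvd_of_pos h hq, (Nat.le_of_dvd hq h).trans hqQ⟩,
        (hco.coprime_dvd_left h).symm⟩, h⟩
    · rintro ⟨_, h⟩
      exact ⟨h, hq.ne'⟩
  · rw [zero_mul]

theorem summable_coprime_moebius_div_sq (L : ℕ) :
    Summable fun n : ℕ => ‖(if L.Coprime n then (ArithmeticFunction.moebius n : ℝ) / (n : ℝ) ^ 2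
      else 0)‖ := by
  refine Summable.of_nonneg_of_le (fun _ => norm_nonneg _) (fun n => ?_) hasSum_zeta_two.summable
  split_ifs
  · rw [Real.norm_eq_abs, abs_div, abs_of_nonneg (sq_nonneg (n : ℝ))]
    gcongr
    exact_mod_cast ArithmeticFunction.abs_moebius_le_one
  · simp

theorem tsum_coprime_moebius_div_sq (L : ℕ) :
    ∑' n : ℕ, (if L.Coprime n then (ArithmeticFunction.moebius n : ℝ) / (n : ℝ) ^ 2 else 0) =
      ∏' p : {p : ℕ // p.Prime ∧ ¬ p ∣ L}, (1 - 1 / (p.1 : ℝ) ^ 2) := by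
  set f : ℕ → ℝ := fun n => if L.Coprime n then
    (ArithmeticFunction.moebius n : ℝ) / (n : ℝ) ^ 2 else 0 with hf
  have h := EulerProduct.eulerProduct_hasProd_mulIndicator (f := f) (by simp [hf])
    (fun {m n} hmn => by
      simp only [hf, Nat.coprime_mul_iff_right]
      by_cases h1 : L.Coprime m <;> by_cases h2 : L.Coprime n <;> simp [h1, h2]
      rw [ArithmeticFunction.isMultiplicative_moebius.map_mul_of_coprime hmn]
      push_cast
      rw [mul_pow, mul_div_mul_comm]
      rw [if_pos ⟨h1, h2⟩, if_pos h2, if_pos h1]) (summable_coprime_moebius_div_sq L) (by simp [hf])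
  rw [← h.tprod_eq]
  refine Eq.trans ?_ (tprod_subtype {p : ℕ | p.Prime ∧ ¬ p ∣ L}
    (fun p => 1 - 1 / (p : ℝ) ^ 2)).symm
  refine tprod_congr fun p => ?_
  by_cases hp : p.Prime
  · rw [Set.mulIndicator_of_mem (show p ∈ {p : ℕ | p.Prime} from hp)]
    have hz : ∀ e, e ∉ Finset.range 2 → f (p ^ e) = 0 := fun e he => by
      have he2 : 2 ≤ e := not_lt.1 fun h => he (Finset.mem_range.2 h)
      simp only [hf]
      rw [ArithmeticFunction.moebius_apply_prime_pow (k := e) hp (by omega),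
        if_neg (show e ≠ 1 by omega)]
      simp
    rw [tsum_eq_sum (s := Finset.range 2) (fun e he => hz e he)]
    by_cases hL : p ∣ L
    · rw [Set.mulIndicator_of_notMem (fun h => h.2 hL)]
      have : ¬ L.Coprime p := fun h => (Nat.Prime.coprime_iff_not_dvd hp).1 h.symm hL
      simp [Finset.sum_range_succ, hf, this]
    · rw [Set.mulIndicator_of_mem (show p ∈ {p : ℕ | p.Prime ∧ ¬ p ∣ L} from ⟨hp, hL⟩)]
      have : L.Coprime p := ((Nat.Prime.coprime_iff_not_dvd hp).2 hL).symm
      simp only [Finset.sum_range_succ, Finset.sum_range_zero, hf, pow_zero, pow_one, if_pos this,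
        ArithmeticFunction.moebius_apply_prime hp]
      simp
      ring
  · rw [Set.mulIndicator_of_notMem (show p ∉ {p : ℕ | p.Prime} from hp),
      Set.mulIndicator_of_notMem (fun h => hp h.1)]

theorem Cconst_eq_tsum (L : ℕ) : Cconst L = (Nat.totient L : ℝ) / L *
    ∑' n : ℕ, (if L.Coprime n then (ArithmeticFunction.moebius n : ℝ) / (n : ℝ) ^ 2 else 0) := by
  rw [tsum_coprime_moebius_div_sq, Cconst]

theorem Cconst_one : Cconst 1 = 1 / zeta2 := by
  have h := ArithmeticFunction.LSeries_zeta_mul_Lseries_moebius (s := 2) (by norm_num)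
  rw [ArithmeticFunction.LSeries_zeta_eq_riemannZeta (by norm_num), riemannZeta_two] at h
  have h2 : LSeries (fun n => ((ArithmeticFunction.moebius n : ℤ) : ℂ)) 2 = (Cconst 1 : ℂ) := by
    rw [Cconst_eq_tsum, LSeries]
    push_cast
    simp only [Nat.totient_one, Nat.cast_one, div_one, one_mul]
    refine tsum_congr fun n => ?_
    rcases eq_or_ne n 0 with rfl | hn
    · simp
    · rw [LSeries.term_of_ne_zero hn, if_pos (Nat.coprime_one_left n)]
      push_cast
      norm_cast
  rw [h2] at h
  have h3 : zeta2 * Cconst 1 = 1 := by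
    rw [zeta2]
    exact_mod_cast h
  exact eq_one_div_of_mul_eq_one_right h3

theorem abs_tsum_coprime_moebius_sub_le (L : ℕ) {Q : ℕ} (hQ : 0 < Q) :
    |∑ d ∈ (Finset.Icc 1 Q).filter (Nat.Coprime L), (ArithmeticFunction.moebius d : ℝ) / (d : ℝ) ^ 2
      - ∑' n : ℕ, (if L.Coprime n then (ArithmeticFunction.moebius n : ℝ) / (n : ℝ) ^ 2 else 0)| ≤
      1 / Q := by
  set f : ℕ → ℝ := fun n => if L.Coprime n then
    (ArithmeticFunction.moebius n : ℝ) / (n : ℝ) ^ 2 else 0 with hf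
  have hs : Summable f := (summable_coprime_moebius_div_sq L).of_norm
  have hle : ∀ n, |f n| ≤ ((n : ℝ) ^ 2)⁻¹ := fun n => by
    simp only [hf]
    split_ifs
    · rw [abs_div, abs_of_nonneg (sq_nonneg (n : ℝ)), ← one_div]
      gcongr
      exact_mod_cast ArithmeticFunction.abs_moebius_le_one
    · simp
  have ht : Tendsto (fun N => |∑ d ∈ Finset.range (Q + 1), f d - ∑ d ∈ Finset.range (N + 1), f d|)
      atTop (nhds |∑ d ∈ Finset.range (Q + 1), f d - ∑' n, f n|) :=
    (tendsto_const_nhds.sub ((tendsto_add_atTop_iff_nat 1).2 hs.hasSum.tendsto_sum_nat)).abs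
  have h0 : ∑ d ∈ (Finset.Icc 1 Q).filter (Nat.Coprime L),
      (ArithmeticFunction.moebius d : ℝ) / (d : ℝ) ^ 2 = ∑ d ∈ Finset.range (Q + 1), f d := by
    rw [Finset.sum_filter, Finset.range_eq_Ico, Finset.sum_eq_sum_Ico_succ_bot (by omega)]
    simp only [hf]
    simp
    rfl
  rw [h0]
  refine le_of_tendsto ht ((eventually_ge_atTop Q).mono fun N hN => ?_)
  rw [abs_sub_comm, ← Finset.sum_range_add_sum_Ico _ (show Q + 1 ≤ N + 1 by omega),
    add_sub_cancel_left]
  refine (Finset.abs_sum_le_sum_abs _ _).trans ((Finset.sum_le_sum fun n _ => hle n).trans ?_)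
  have h1 : Finset.Ico (Q + 1) (N + 1) = Finset.Ioc Q N := by
    ext n
    rw [Finset.mem_Ico, Finset.mem_Ioc]
    omega
  rw [h1]
  refine (sum_Ioc_inv_sq_le_sub hQ.ne' hN).trans ?_
  rw [one_div]
  have : (0 : ℝ) ≤ (N : ℝ)⁻¹ := by positivity
  linarith

theorem abs_sum_dvd_sub_integral_le {h : ℝ → ℝ} {K M : ℝ}
    (hK : ∀ x y, |h x - h y| ≤ K * |x - y|) (hM : ∀ x, |h x| ≤ M) {lam : ℝ}
    (hlam : lam ∈ Set.Ioc (0 : ℝ) 1) {Q g L : ℕ} (hQ : 0 < Q) (hg : 0 < g) (hgL : g ≤ L * Q) :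
    |∑ q ∈ Finset.Ioc ⌊lam * Q⌋₊ Q, (if g ∣ q then 1 / (Q : ℝ) * h (q / Q) else 0) -
      (∫ x in lam..1, h x) / g| ≤ (K * (1 + L) + 2 * M) / Q := by
  have hQ' : (0 : ℝ) < Q := by exact_mod_cast hQ
  have hg' : (0 : ℝ) < g := by exact_mod_cast hg
  have hK0 : 0 ≤ K := by simpa using (abs_nonneg _).trans (hK 1 0)
  have hη : (0 : ℝ) < g / Q := by positivity
  have hηL : (g : ℝ) / Q ≤ L := by
    rw [div_le_iff₀ hQ']; exact_mod_cast hgL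
  have key := abs_riemann_sum_sub_integral_le hK hM hη 0 hlam.2
  have e1 : ∑ q ∈ Finset.Ioc ⌊lam * Q⌋₊ Q, (if g ∣ q then 1 / (Q : ℝ) * h (q / Q) else 0) =
      1 / Q * ∑ j ∈ Finset.Ioc ⌊(lam - 0) / ((g : ℝ) / Q)⌋ ⌊(1 - 0) / ((g : ℝ) / Q)⌋,
        h (0 + g / Q * j) := by
    rw [← Finset.sum_filter, Finset.mul_sum]
    have hl0 : 0 ≤ lam * Q := mul_nonneg hlam.1.le hQ'.le
    refine Finset.sum_bij' (fun q _ => ((q / g : ℕ) : ℤ)) (fun j _ => g * j.toNat) ?_ ?_ ?_ ?_ ?_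
    · intro q hq
      simp only [Finset.mem_filter, Finset.mem_Ioc, Nat.floor_lt hl0] at hq
      obtain ⟨⟨h1, h2⟩, k, rfl⟩ := hq
      rw [Nat.mul_div_cancel_left _ hg, Finset.mem_Ioc, Int.floor_lt, Int.le_floor, sub_zero,
        sub_zero, div_div_eq_mul_div, div_div_eq_mul_div, div_lt_iff₀ hg', le_div_iff₀ hg']
      push_cast at h1 ⊢
      have h2' : (g : ℝ) * k ≤ Q := by exact_mod_cast h2
      constructor <;> linarith
    · intro j hj
      rw [Finset.mem_Ioc, Int.floor_lt, Int.le_floor, sub_zero,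
        sub_zero, div_div_eq_mul_div, div_div_eq_mul_div, div_lt_iff₀ hg', le_div_iff₀ hg'] at hj
      have hj0 : (0 : ℝ) < j := by
        by_contra hcon
        nlinarith [hj.1]
      have hj1 : 0 < j := by exact_mod_cast hj0
      lift j to ℕ using hj1.le
      simp only [Finset.mem_filter, Finset.mem_Ioc, Nat.floor_lt hl0, Int.toNat_natCast,
        dvd_mul_right, and_true]
      have h1 := hj.1
      have h2 := hj.2
      push_cast at h1 h2 ⊢
      refine ⟨by linarith, ?_⟩
      have : ((g * j : ℕ) : ℝ) ≤ (Q : ℕ) := by push_cast; linarith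
      exact_mod_cast this
    · intro q hq
      simp only [Finset.mem_filter] at hq
      rw [Int.toNat_natCast]
      exact Nat.mul_div_cancel' hq.2
    · intro j hj
      rw [Finset.mem_Ioc, Int.floor_lt, sub_zero, div_div_eq_mul_div, div_lt_iff₀ hg'] at hj
      have hj0 : (0 : ℝ) < j := by
        by_contra hcon
        nlinarith [hj.1]
      have hj1 : 0 < j := by exact_mod_cast hj0
      rw [Nat.mul_div_cancel_left _ hg, Int.toNat_of_nonneg hj1.le]
    · intro q hq
      simp only [Finset.mem_filter] at hq
      obtain ⟨_, k, rfl⟩ := hq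
      rw [Nat.mul_div_cancel_left _ hg]
      congr 2
      push_cast
      ring
  rw [e1]
  have e2 : ∀ X J : ℝ, 1 / Q * X - J / g = (1 / g) * ((g : ℝ) / Q * X - J) := fun X J => by
    field_simp
  rw [e2, abs_mul, abs_of_pos (show (0 : ℝ) < 1 / g by positivity)]
  calc _ ≤ 1 / (g : ℝ) * (g / Q * (K * (1 - lam + g / Q) + 2 * M)) := by gcongr
    _ = (K * (1 - lam + g / Q) + 2 * M) / Q := by field_simp
    _ ≤ _ := by
      have := hlam.1.le
      gcongr
      linarith

theorem exists_sum_coprime_totient_sub_le {L : ℕ} (hL : 0 < L) {h : ℝ → ℝ} {K M : ℝ}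
    (hK : ∀ x y, |h x - h y| ≤ K * |x - y|) (hM : ∀ x, |h x| ≤ M) {lam : ℝ}
    (hlam : lam ∈ Set.Ioc (0 : ℝ) 1) :
    ∃ C, 0 < C ∧ ∀ Q : ℕ, 0 < Q →
      |∑ q ∈ Finset.Ioc ⌊lam * Q⌋₊ Q, (if q.Coprime L then (Nat.totient q : ℝ) / q else 0) *
        (1 / Q * h (q / Q)) - Cconst L * ∫ x in lam..1, h x| ≤ C * (Q : ℝ) ^ (-(1 / 2) : ℝ) := by
  have hK0 : 0 ≤ K := by simpa using (abs_nonneg _).trans (hK 1 0)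
  have hM0 : 0 ≤ M := (abs_nonneg _).trans (hM 0)
  set C₁ := K * (1 + L) + 2 * M with hC₁
  have hC₁0 : 0 ≤ C₁ := by positivity
  refine ⟨L.divisors.card * (3 * C₁) + M + 1, by positivity, fun Q hQ => ?_⟩
  have hQ1 : (1 : ℝ) ≤ Q := by exact_mod_cast hQ
  have hQ0 : (0 : ℝ) < Q := by linarith
  set J := ∫ x in lam..1, h x with hJ
  set D := (Finset.Icc 1 Q).filter (Nat.Coprime L) with hD
  set T : ℕ → ℝ := fun g => ∑ q ∈ Finset.Ioc ⌊lam * Q⌋₊ Q,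
    (if g ∣ q then 1 / (Q : ℝ) * h (q / Q) else 0) with hT
  have hJM : |J| ≤ M := by
    have := intervalIntegral.norm_integral_le_of_norm_le_const (f := h) (a := lam) (b := 1)
      (C := M) (fun x _ => hM x)
    rw [Real.norm_eq_abs, abs_of_nonneg (sub_nonneg.2 hlam.2)] at this
    exact this.trans (mul_le_of_le_one_right hM0 (by linarith [hlam.1]))
  have e1 : ∑ q ∈ Finset.Ioc ⌊lam * Q⌋₊ Q, (if q.Coprime L then (Nat.totient q : ℝ) / q else 0) *
        (1 / Q * h (q / Q)) = ∑ e ∈ L.divisors, ∑ d ∈ D, (ArithmeticFunction.moebius e : ℝ) *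
          ((ArithmeticFunction.moebius d : ℝ) / d) * T (d * e) := by
    simp only [hT, Finset.mul_sum]
    rw [Finset.sum_congr rfl fun e _ => Finset.sum_comm, Finset.sum_comm]
    refine Finset.sum_congr rfl fun q hq => ?_
    rw [Finset.mem_Ioc] at hq
    rw [coprime_totient_div_eq hL (Nat.zero_lt_of_lt hq.1) hq.2, Finset.sum_mul]
    refine Finset.sum_congr rfl fun e _ => ?_
    rw [Finset.sum_mul]
    refine Finset.sum_congr rfl fun d _ => ?_
    split_ifs <;> ring
  have e2 : (Nat.totient L : ℝ) / L *
      (∑ d ∈ D, (ArithmeticFunction.moebius d : ℝ) / (d : ℝ) ^ 2) * J =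
      ∑ e ∈ L.divisors, ∑ d ∈ D, (ArithmeticFunction.moebius e : ℝ) *
          ((ArithmeticFunction.moebius d : ℝ) / d) * (J / (d * e : ℕ)) := by
    rw [sum_totient_inversion hL, Finset.sum_mul_sum, Finset.sum_mul]
    refine Finset.sum_congr rfl fun e _ => ?_
    rw [Finset.sum_mul]
    refine Finset.sum_congr rfl fun d _ => ?_
    push_cast
    ring
  have hharm : ∑ d ∈ D, 1 / (d : ℝ) ≤ 1 + Real.log Q := by
    have h1 := harmonic_le_one_add_log Q
    rw [harmonic_eq_sum_Icc] at h1
    push_cast at h1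
    refine le_trans ?_ h1
    simp only [one_div]
    exact Finset.sum_le_sum_of_subset_of_nonneg (Finset.filter_subset _ _) fun _ _ _ => by
      positivity
  have hlog : (1 + Real.log Q) / Q ≤ 3 * (Q : ℝ) ^ (-(1 / 2) : ℝ) := by
    have h1 := Real.log_le_rpow_div hQ0.le (show (0 : ℝ) < 1 / 2 by norm_num)
    have h2 : (1 : ℝ) ≤ (Q : ℝ) ^ (1 / 2 : ℝ) := Real.one_le_rpow hQ1 (by norm_num)
    rw [div_le_iff₀ hQ0]
    have h3 : (Q : ℝ) ^ (-(1 / 2) : ℝ) * Q = (Q : ℝ) ^ (1 / 2 : ℝ) := by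
      rw [← Real.rpow_add_one hQ0.ne']; norm_num
    rw [mul_assoc, h3]
    linarith
  have b1 : |∑ e ∈ L.divisors, ∑ d ∈ D, (ArithmeticFunction.moebius e : ℝ) *
      ((ArithmeticFunction.moebius d : ℝ) / d) * T (d * e) -
      ∑ e ∈ L.divisors, ∑ d ∈ D, (ArithmeticFunction.moebius e : ℝ) *
          ((ArithmeticFunction.moebius d : ℝ) / d) * (J / (d * e : ℕ))| ≤
      L.divisors.card * (3 * C₁) * (Q : ℝ) ^ (-(1 / 2) : ℝ) := by
    rw [← Finset.sum_sub_distrib]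
    refine (Finset.abs_sum_le_sum_abs _ _).trans ?_
    rw [mul_assoc, ← nsmul_eq_mul]
    refine Finset.sum_le_card_nsmul _ _ _ fun e he => ?_
    rw [← Finset.sum_sub_distrib]
    refine (Finset.abs_sum_le_sum_abs _ _).trans ?_
    calc _ ≤ ∑ d ∈ D, 1 / (d : ℝ) * (C₁ / Q) := by
          refine Finset.sum_le_sum fun d hd => ?_
          have hd' := Finset.mem_Icc.1 (Finset.mem_filter.1 hd).1
          rw [← mul_sub, abs_mul, abs_mul, abs_div]
          have hme : |(ArithmeticFunction.moebius e : ℝ)| ≤ 1 := by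
            exact_mod_cast ArithmeticFunction.abs_moebius_le_one
          have hmd : |(ArithmeticFunction.moebius d : ℝ)| ≤ 1 := by
            exact_mod_cast ArithmeticFunction.abs_moebius_le_one
          have he0 := Nat.pos_of_mem_divisors he
          have hin := abs_sum_dvd_sub_integral_le hK hM hlam hQ (g := d * e) (L := L)
            (Nat.mul_pos hd'.1 he0) (by
              rw [mul_comm]
              exact Nat.mul_le_mul (Nat.le_of_dvd hL (Nat.dvd_of_mem_divisors he)) hd'.2)
          calc _ ≤ 1 * (1 / |(d : ℝ)|) * (C₁ / Q) := by gcongr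
            _ = _ := by rw [one_mul, Nat.abs_cast]
      _ = (∑ d ∈ D, 1 / (d : ℝ)) * (C₁ / Q) := by rw [Finset.sum_mul]
      _ ≤ (1 + Real.log Q) * (C₁ / Q) := by gcongr
      _ = C₁ * ((1 + Real.log Q) / Q) := by ring
      _ ≤ C₁ * (3 * (Q : ℝ) ^ (-(1 / 2) : ℝ)) := by gcongr
      _ = _ := by ring
  have b2 : |(Nat.totient L : ℝ) / L *
      (∑ d ∈ D, (ArithmeticFunction.moebius d : ℝ) / (d : ℝ) ^ 2) * J - Cconst L * J| ≤
      M * (Q : ℝ) ^ (-(1 / 2) : ℝ) := by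
    rw [Cconst_eq_tsum, ← sub_mul, ← mul_sub, abs_mul, abs_mul]
    have h1 : |(Nat.totient L : ℝ) / L| ≤ 1 := by
      rw [abs_of_nonneg (by positivity)]
      exact div_le_one_of_le₀ (by exact_mod_cast Nat.totient_le L) (by positivity)
    have h2 : 1 / (Q : ℝ) ≤ (Q : ℝ) ^ (-(1 / 2) : ℝ) := by
      rw [one_div, ← Real.rpow_neg_one]
      exact Real.rpow_le_rpow_of_exponent_le hQ1 (by norm_num)
    have h3 := (abs_tsum_coprime_moebius_sub_le L hQ).trans h2
    calc _ ≤ 1 * (Q : ℝ) ^ (-(1 / 2) : ℝ) * M := by gcongr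
      _ = _ := by ring
  rw [e1]
  rw [← e2] at b1
  have h1 : (0 : ℝ) ≤ (Q : ℝ) ^ (-(1 / 2) : ℝ) := by positivity
  refine (abs_sub_le _ _ _).trans ((add_le_add b1 b2).trans ?_)
  nlinarith

theorem abs_log_sub_log_le {lam x y : ℝ} (hl : 0 < lam) (hx : lam ≤ x) (hy : lam ≤ y) :
    |Real.log x - Real.log y| ≤ lam⁻¹ * |x - y| := by
  have key : ∀ x y : ℝ, lam ≤ x → lam ≤ y → Real.log x - Real.log y ≤ lam⁻¹ * |x - y| := by
    intro x y hx hy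
    have hx0 := hl.trans_le hx
    have hy0 := hl.trans_le hy
    rw [← Real.log_div hx0.ne' hy0.ne']
    refine (Real.log_le_sub_one_of_pos (by positivity)).trans ?_
    have : x / y - 1 = y⁻¹ * (x - y) := by field_simp
    rw [this]
    calc y⁻¹ * (x - y) ≤ y⁻¹ * |x - y| := by gcongr; exact le_abs_self _
      _ ≤ _ := by gcongr
  rw [abs_le]
  have h1 := key x y hx hy
  have h2 := key y x hy hx
  rw [abs_sub_comm] at h2
  constructor <;> linarith

theorem abs_inv_max_sub_le {lam : ℝ} (hl : 0 < lam) (x y : ℝ) :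
    |(max lam x)⁻¹ - (max lam y)⁻¹| ≤ lam⁻¹ ^ 2 * |x - y| := by
  have hx : lam ≤ max lam x := le_max_left _ _
  have hy : lam ≤ max lam y := le_max_left _ _
  have hx0 := hl.trans_le hx
  have hy0 := hl.trans_le hy
  have e : (max lam x)⁻¹ - (max lam y)⁻¹ =
      (max lam x)⁻¹ * (max lam y)⁻¹ * (max lam y - max lam x) := by field_simp
  have h1 : |max lam y - max lam x| ≤ |x - y| := by
    rw [abs_sub_comm x y]
    exact (abs_max_sub_max_le_max _ _ _ _).trans (by simp)
  rw [e, abs_mul, abs_of_pos (show 0 < (max lam x)⁻¹ * (max lam y)⁻¹ by positivity), pow_two]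
  gcongr

theorem abs_inv_one_add_sq_sub_le (x y : ℝ) :
    |1 / (1 + x ^ 2) - 1 / (1 + y ^ 2)| ≤ 1 * |x - y| := by
  have e : 1 / (1 + x ^ 2) - 1 / (1 + y ^ 2) =
      (-(x + y) / ((1 + x ^ 2) * (1 + y ^ 2))) * (x - y) := by
    field_simp
    ring
  rw [e, abs_mul]
  gcongr
  rw [abs_div, abs_of_pos (show 0 < (1 + x ^ 2) * (1 + y ^ 2) by positivity),
    div_le_one (by positivity), abs_le]
  constructor <;> nlinarith [sq_nonneg (x - y), sq_nonneg (x + y), sq_nonneg (x * y),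
    sq_nonneg (x + y - 1), sq_nonneg (x + y + 1)]

theorem abs_inv_one_add_sq_le (x : ℝ) : |1 / (1 + x ^ 2)| ≤ 1 := by
  rw [abs_of_pos (by positivity), div_le_one (by positivity)]
  nlinarith [sq_nonneg x]

/-- A bounded Lipschitz extension to the real line of the integrand of `I1`. -/
noncomputable def kernelExt (lam x : ℝ) : ℝ :=
  (max lam x)⁻¹ * -Real.log (max lam (min 1 (1 - x)))

theorem neg_log_max_min_bounds {lam : ℝ} (hlam : lam ∈ Set.Ioc (0 : ℝ) 1) (x : ℝ) :
    0 ≤ -Real.log (max lam (min 1 (1 - x))) ∧ -Real.log (max lam (min 1 (1 - x))) ≤ lam⁻¹ := by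
  have h1 : lam ≤ max lam (min 1 (1 - x)) := le_max_left _ _
  have h2 : max lam (min 1 (1 - x)) ≤ 1 := max_le hlam.2 (min_le_left _ _)
  have h0 := hlam.1.trans_le h1
  refine ⟨neg_nonneg.2 (Real.log_nonpos h0.le h2), ?_⟩
  rw [← Real.log_inv]
  refine (Real.log_le_sub_one_of_pos (by positivity)).trans ?_
  have := inv_anti₀ hlam.1 h1
  linarith

theorem abs_kernelExt_le {lam : ℝ} (hlam : lam ∈ Set.Ioc (0 : ℝ) 1) (x : ℝ) :
    |kernelExt lam x| ≤ lam⁻¹ ^ 2 := by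
  obtain ⟨h1, h2⟩ := neg_log_max_min_bounds hlam x
  have h3 := inv_anti₀ hlam.1 (le_max_left lam x)
  have h4 : 0 < max lam x := hlam.1.trans_le (le_max_left lam x)
  have := hlam.1
  rw [kernelExt, abs_of_nonneg (mul_nonneg (by positivity) h1), pow_two]
  gcongr

theorem abs_kernelExt_sub_le {lam : ℝ} (hlam : lam ∈ Set.Ioc (0 : ℝ) 1) (x y : ℝ) :
    |kernelExt lam x - kernelExt lam y| ≤ (2 * lam⁻¹ ^ 3) * |x - y| := by
  have hl := hlam.1
  have h1 : 1 ≤ lam⁻¹ := (one_le_inv₀ hl).2 hlam.2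
  obtain ⟨h2, h3⟩ := neg_log_max_min_bounds hlam x
  have h4 := abs_inv_max_sub_le hl x y
  have h5 := abs_log_sub_log_le hl (le_max_left lam (min 1 (1 - x)))
    (le_max_left lam (min 1 (1 - y)))
  have h6 : |max lam (min 1 (1 - x)) - max lam (min 1 (1 - y))| ≤ |x - y| := by
    refine (abs_max_sub_max_le_max _ _ _ _).trans ?_
    rw [sub_self, abs_zero]
    refine max_le (abs_nonneg _) ((abs_min_sub_min_le_max _ _ _ _).trans ?_)
    rw [sub_self, abs_zero]
    refine max_le (abs_nonneg _) (le_of_eq ?_)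
    rw [abs_sub_comm]
    congr 1
    ring
  have h7 : |(max lam y)⁻¹| ≤ lam⁻¹ := by
    rw [abs_of_pos (by have := hl.trans_le (le_max_left lam y); positivity)]
    exact inv_anti₀ hl (le_max_left _ _)
  have e : kernelExt lam x - kernelExt lam y =
      ((max lam x)⁻¹ - (max lam y)⁻¹) * -Real.log (max lam (min 1 (1 - x))) -
      (max lam y)⁻¹ * (Real.log (max lam (min 1 (1 - x))) -
        Real.log (max lam (min 1 (1 - y)))) := by
    rw [kernelExt, kernelExt]; ring
  rw [e]
  refine (abs_sub _ _).trans ?_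
  rw [abs_mul, abs_mul, abs_of_nonneg h2]
  calc _ ≤ lam⁻¹ ^ 2 * |x - y| * lam⁻¹ + lam⁻¹ * (lam⁻¹ * |x - y|) := by
        gcongr
        exact h5.trans (by gcongr)
    _ ≤ lam⁻¹ ^ 2 * |x - y| * lam⁻¹ + lam⁻¹ * (lam⁻¹ * |x - y|) * lam⁻¹ := by
        refine add_le_add le_rfl ?_
        exact le_mul_of_one_le_right (by positivity) h1
    _ = _ := by ring

theorem integral_kernelExt {lam : ℝ} (hlam : lam ∈ Set.Ioc (0 : ℝ) 1) :
    ∫ x in lam..1, kernelExt lam x = I1 lam := by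
  rw [I1]
  refine intervalIntegral.integral_congr fun x hx => ?_
  rw [Set.uIcc_of_le hlam.2] at hx
  have := hlam.1
  simp only [kernelExt]
  rw [max_eq_right hx.1, min_eq_right (by linarith [hx.1]), one_div, one_div, Real.log_inv]

/-- The weighted count of solutions of `a * b ≡ u (mod q)` with `a / q ∈ (α, β]`,
`a ≡ q (mod L)` and `max (λ Q) (Q - q) < b ≤ Q`. -/
noncomputable def congSum (L : ℕ) (u : ℤ) (α β lam : ℝ) (Q q : ℕ) : ℝ :=
  ∑ a ∈ Finset.Ioc ⌊α * q⌋ ⌊β * q⌋, ∑ b ∈ Finset.Ioc ⌊max lam (1 - q / Q) * Q⌋ (Q : ℤ),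
    if (L : ℤ) ∣ q - a ∧ (q : ℤ) ∣ a * b - u then
      1 / (1 + ((a : ℝ) / q) ^ 2) * (1 / (q * b)) else 0

theorem congSum_eq_zero {L : ℕ} {u : ℤ} (hu : IsUnit u) {α β lam : ℝ} {Q q : ℕ}
    (hq : ¬ q.Coprime L) : congSum L u α β lam Q q = 0 := by
  refine Finset.sum_eq_zero fun a _ => Finset.sum_eq_zero fun b _ => if_neg ?_
  rintro ⟨h1, h2⟩
  apply hq
  have hg1 : ((Nat.gcd q L : ℕ) : ℤ) ∣ q := by exact_mod_cast Nat.gcd_dvd_left q L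
  have hg2 : ((Nat.gcd q L : ℕ) : ℤ) ∣ L := by exact_mod_cast Nat.gcd_dvd_right q L
  have h3 : ((Nat.gcd q L : ℕ) : ℤ) ∣ a := by
    have := dvd_sub hg1 (hg2.trans h1)
    simpa using this
  have h4 : ((Nat.gcd q L : ℕ) : ℤ) ∣ u := by
    have := dvd_sub (h3.mul_right b) (hg1.trans h2)
    simpa using this
  have h5 := isUnit_of_dvd_unit h4 hu
  rw [Int.ofNat_isUnit, Nat.isUnit_iff] at h5
  exact h5

theorem congSum_eq {L : ℕ} (hL : 0 < L) {u : ℤ} {α β lam : ℝ} {Q q : ℕ} (hq : 0 < q)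
    (c v : (ZMod q)ˣ) (hc : (c : ZMod q) = L) (hv : (v : ZMod q) = u) :
    congSum L u α β lam Q q =
      ∑ j ∈ Finset.Ioc ⌊(α - 1) / ((L : ℝ) / q)⌋ ⌊(β - 1) / ((L : ℝ) / q)⌋,
        ∑ b ∈ Finset.Ioc ⌊max lam (1 - q / Q) * Q⌋ (Q : ℤ),
        if (c : ZMod q) * (j : ZMod q) * (b : ZMod q) = v then
          1 / (1 + (1 + (L : ℝ) / q * j) ^ 2) * (1 / (q * b)) else 0 := by
  have hq' : (0 : ℝ) < q := by exact_mod_cast hq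
  have hL' : (0 : ℝ) < L := by exact_mod_cast hL
  rw [congSum]
  have h1 : ∀ a ∈ Finset.Ioc ⌊α * q⌋ ⌊β * q⌋,
      (∑ b ∈ Finset.Ioc ⌊max lam (1 - q / Q) * Q⌋ (Q : ℤ),
        if (L : ℤ) ∣ q - a ∧ (q : ℤ) ∣ a * b - u then
        1 / (1 + ((a : ℝ) / q) ^ 2) * (1 / (q * b)) else 0) =
      if (L : ℤ) ∣ q - a then ∑ b ∈ Finset.Ioc ⌊max lam (1 - q / Q) * Q⌋ (Q : ℤ),
        (if (q : ℤ) ∣ a * b - u then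
        1 / (1 + ((a : ℝ) / q) ^ 2) * (1 / (q * b)) else 0) else 0 := by
    intro a _
    split_ifs with h <;> simp [h]
  rw [Finset.sum_congr rfl h1, ← Finset.sum_filter]
  symm
  refine Finset.sum_bij (fun j _ => q + L * j) ?_ ?_ ?_ ?_
  · intro j hj
    rw [Finset.mem_Ioc, Int.floor_lt, Int.le_floor, div_div_eq_mul_div, div_div_eq_mul_div,
      div_lt_iff₀ hL', le_div_iff₀ hL'] at hj
    rw [Finset.mem_filter, Finset.mem_Ioc, Int.floor_lt, Int.le_floor]
    push_cast
    refine ⟨⟨by linarith [hj.1], by linarith [hj.2]⟩, -j, by ring⟩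
  · intro i _ j _ h
    simpa [hL.ne'] using h
  · intro a ha
    rw [Finset.mem_filter, Finset.mem_Ioc, Int.floor_lt, Int.le_floor] at ha
    obtain ⟨⟨h2, h3⟩, k, hk⟩ := ha
    have ha' : a = q + L * (-k) := by linarith
    refine ⟨-k, ?_, ha'.symm⟩
    rw [ha'] at h2 h3
    push_cast at h2 h3
    rw [Finset.mem_Ioc, Int.floor_lt, Int.le_floor, div_div_eq_mul_div, div_div_eq_mul_div,
      div_lt_iff₀ hL', le_div_iff₀ hL']
    push_cast
    exact ⟨by linarith, by linarith⟩
  · intro j _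
    refine Finset.sum_congr rfl fun b _ => ?_
    have e1 : ((q : ℤ) ∣ (q + L * j) * b - u) ↔
        (c : ZMod q) * (j : ZMod q) * (b : ZMod q) = v := by
      rw [← ZMod.intCast_zmod_eq_zero_iff_dvd, hc, hv]
      push_cast
      rw [ZMod.natCast_self, zero_add, sub_eq_zero]
    have e2 : (((q + L * j : ℤ) : ℝ)) / q = 1 + (L : ℝ) / q * j := by
      push_cast
      field_simp
    simp only [e1, e2]

theorem sum_inv_sub_log_le {lam μ : ℝ} (hl : 0 < lam) (hμ : lam ≤ μ) (hμ1 : μ ≤ 1) (hlam : lam ≤ 1)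
    {Q : ℕ} (hQ : 0 < Q) :
    |∑ b ∈ Finset.Ioc ⌊μ * Q⌋ (Q : ℤ), 1 / (b : ℝ) - -Real.log μ| ≤ 4 * lam⁻¹ ^ 2 / Q := by
  have hQ' : (1 : ℝ) ≤ Q := by exact_mod_cast hQ
  have hQ0 : (0 : ℝ) < Q := by linarith
  have h1 : 1 ≤ lam⁻¹ := (one_le_inv₀ hl).2 hlam
  have key := abs_riemann_sum_sub_integral_le (h := fun x => (max lam x)⁻¹) (K := lam⁻¹ ^ 2)
    (M := lam⁻¹) (abs_inv_max_sub_le hl) (fun x => by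
      rw [abs_of_pos (by have := hl.trans_le (le_max_left lam x); positivity)]
      exact inv_anti₀ hl (le_max_left _ _)) (η := 1 / Q) (by positivity) 0 hμ1
  have e1 : ∫ x in μ..1, (max lam x)⁻¹ = -Real.log μ := by
    rw [intervalIntegral.integral_congr (g := fun x => x⁻¹) (fun x hx => by
      rw [Set.uIcc_of_le hμ1] at hx
      simp only [max_eq_right (hμ.trans hx.1)]), integral_inv_of_pos (hl.trans_le hμ) one_pos,
      one_div, Real.log_inv]
  have e2 : (1 / (Q : ℝ)) * ∑ j ∈ Finset.Ioc ⌊(μ - 0) / (1 / (Q : ℝ))⌋ ⌊(1 - 0) / (1 / (Q : ℝ))⌋,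
      (max lam (0 + 1 / (Q : ℝ) * j))⁻¹ = ∑ b ∈ Finset.Ioc ⌊μ * Q⌋ (Q : ℤ), 1 / (b : ℝ) := by
    rw [sub_zero, sub_zero, div_div_eq_mul_div, div_div_eq_mul_div, div_one, div_one, one_mul,
      Int.floor_natCast, Finset.mul_sum]
    refine Finset.sum_congr rfl fun b hb => ?_
    rw [Finset.mem_Ioc, Int.floor_lt] at hb
    have h2 : lam ≤ 0 + 1 / (Q : ℝ) * b := by
      rw [zero_add, one_div, inv_mul_eq_div, le_div_iff₀ hQ0]
      exact (mul_le_mul_of_nonneg_right hμ hQ0.le).trans hb.1.le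
    rw [max_eq_right h2, zero_add]
    field_simp
  rw [e1, e2] at key
  refine key.trans ?_
  have h3 : (1 : ℝ) / Q ≤ 1 := by rw [div_le_one hQ0]; exact hQ'
  calc _ ≤ 1 / (Q : ℝ) * (lam⁻¹ ^ 2 * 2 + 2 * (lam⁻¹ * lam⁻¹)) := by
        gcongr
        · linarith
        · exact le_mul_of_one_le_right (by positivity) h1
    _ = _ := by ring

set_option maxHeartbeats 400000 in
theorem exists_abs_congSum_sub_le {L : ℕ} (hL : 0 < L) {lam : ℝ}
    (hlam : lam ∈ Set.Ioc (0 : ℝ) 1) :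
    ∃ C, 0 < C ∧ ∀ Q q : ℕ, 0 < Q → q ∈ Finset.Ioc ⌊lam * Q⌋₊ Q → ∀ u : ℤ, IsUnit u →
      ∀ α β : ℝ, 0 ≤ α → α ≤ β → β ≤ 1 →
      |congSum L u α β lam Q q - (if q.Coprime L then (Nat.totient q : ℝ) / q else 0) *
        (1 / Q * kernelExt lam (q / Q)) * ((∫ x in α..β, 1 / (1 + x ^ 2)) / L)| ≤
        C * (Q : ℝ) ^ (-(7 / 6) : ℝ) := by
  obtain ⟨C, hC, hmod⟩ := exists_abs_modular_hyperbola_sub_le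
  have hl := hlam.1
  have hL1 : (1 : ℝ) ≤ L := by exact_mod_cast hL
  have hL0 : (0 : ℝ) < L := by linarith
  refine ⟨C * lam⁻¹ ^ 2 + lam⁻¹ ^ 2 * (4 * lam⁻¹ ^ 2 * (4 + L) + lam⁻¹ * (3 + L)), by positivity,
    fun Q q hQ hq u hu α β hα hαβ hβ => ?_⟩
  have hQ1 : (1 : ℝ) ≤ Q := by exact_mod_cast hQ
  have hQ0 : (0 : ℝ) < Q := by linarith
  rw [Finset.mem_Ioc, Nat.floor_lt (by positivity)] at hq
  obtain ⟨hqlo, hqQ⟩ := hq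
  have hq0 : (0 : ℝ) < q := lt_of_le_of_lt (by positivity) hqlo
  have hqn : 0 < q := by exact_mod_cast hq0
  have hq1 : (1 : ℝ) ≤ q := by exact_mod_cast hqn
  have hqQ' : (q : ℝ) ≤ Q := by exact_mod_cast hqQ
  by_cases hco : q.Coprime L
  swap
  · rw [congSum_eq_zero hu hco, if_neg hco]
    simp only [zero_mul, sub_zero, abs_zero]
    positivity
  rw [if_pos hco]
  have : NeZero q := ⟨hqn.ne'⟩
  set c : (ZMod q)ˣ := ZMod.unitOfCoprime L hco.symm with hc
  set v : (ZMod q)ˣ := Units.map (Int.castRingHom (ZMod q)).toMonoidHom hu.unit with hv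
  have hcv : (c : ZMod q) = L := ZMod.coe_unitOfCoprime L hco.symm
  have hvv : (v : ZMod q) = u := rfl
  rw [congSum_eq hL hqn c v hcv hvv]
  set μ := max lam (1 - (q : ℝ) / Q) with hμ
  have hμl : lam ≤ μ := le_max_left _ _
  have hμ1 : μ ≤ 1 := max_le hlam.2 (by
    have : 0 ≤ (q : ℝ) / Q := by positivity
    linarith)
  have hμ2 : (Q : ℝ) - q ≤ μ * Q := by
    have : (1 - (q : ℝ) / Q) * Q ≤ μ * Q := by gcongr; exact le_max_right _ _
    have e : (1 - (q : ℝ) / Q) * Q = Q - q := by field_simp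
    linarith
  set η := (L : ℝ) / q with hη
  have hη0 : 0 < η := by positivity
  have hηL : η ≤ L := div_le_self hL0.le hq1
  set A := ⌊(α - 1) / η⌋ with hA
  set B := ⌊(β - 1) / η⌋ with hB
  set A' := ⌊μ * Q⌋ with hA'
  set w : ℤ → ℝ := fun j => 1 / (1 + (1 + η * j) ^ 2) with hw
  set y : ℤ → ℝ := fun b => 1 / ((q : ℝ) * b) with hy
  have hpos : ∀ j : ℤ, A < j → 0 ≤ 1 + η * j := fun j hj => by
    rw [hA, Int.floor_lt, div_lt_iff₀ hη0] at hj
    linarith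
  have hpos' : ∀ b : ℤ, A' < b → lam * Q < b := fun b hb => by
    rw [hA', Int.floor_lt] at hb
    exact lt_of_le_of_lt (by gcongr) hb
  have hlQ : 0 < lam * Q := by positivity
  have hV : ∀ b : ℤ, A' < b → y b ≤ 1 / (lam * Q) ^ 2 := fun b hb => by
    have := hpos' b hb
    simp only [hy]
    rw [pow_two]
    gcongr
  have hBA : B - A ≤ 2 * q := by
    have h1 : (B : ℝ) ≤ (β - 1) / η := Int.floor_le _
    have h2 : (α - 1) / η < A + 1 := Int.lt_floor_add_one _
    have h3 : (β - 1) / η - (α - 1) / η ≤ q := by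
      rw [← sub_div, hη, div_div_eq_mul_div, div_le_iff₀ hL0]
      nlinarith
    have h4 : (B : ℝ) - A < q + 1 := by linarith
    have h5 : B - A < q + 1 := by exact_mod_cast h4
    omega
  have hBA' : (Q : ℤ) - A' ≤ 2 * q := by
    have h2 : μ * Q < A' + 1 := Int.lt_floor_add_one _
    have h4 : (Q : ℝ) - A' < q + 1 := by linarith
    have h5 : (Q : ℤ) - A' < q + 1 := by exact_mod_cast h4
    omega
  have hm := hmod Q q hqQ v c (w := w) (v := y) (A := A) (B := B) (A' := A') (B' := Q)
    (W := 1) (V := 1 / (lam * Q) ^ 2) (fun j _ => by simp only [hw]; positivity)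
    (fun j _ => (le_abs_self _).trans (abs_inv_one_add_sq_le _))
    (fun j hj => by
      have := hpos j hj
      simp only [hw]
      push_cast
      gcongr
      linarith) zero_le_one
    (fun b hb => by
      have := hlQ.trans (hpos' b hb)
      simp only [hy]; positivity)
    hV (fun b hb => by
      have := hlQ.trans (hpos' b hb)
      simp only [hy]
      push_cast
      gcongr
      linarith) (by positivity) hBA hBA'
  have hX := sum_inv_sub_log_le hl hμl hμ1 hlam.2 hQ
  have hY := abs_riemann_sum_sub_integral_le abs_inv_one_add_sq_sub_le abs_inv_one_add_sq_le hη0 1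
    hαβ
  set cI := ∫ x in α..β, 1 / (1 + x ^ 2) with hcI
  set X := ∑ b ∈ Finset.Ioc A' (Q : ℤ), 1 / (b : ℝ) with hXdef
  set Y := ∑ j ∈ Finset.Ioc A B, w j with hYdef
  have hXe : ∑ b ∈ Finset.Ioc A' (Q : ℤ), y b = 1 / q * X := by
    rw [hXdef, Finset.mul_sum]
    refine Finset.sum_congr rfl fun b _ => ?_
    simp only [hy]
    rw [one_div_mul_one_div]
  rw [hXe] at hm
  have hker : 1 / (Q : ℝ) * kernelExt lam (q / Q) = 1 / q * -Real.log μ := by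
    have h1 : lam ≤ (q : ℝ) / Q := by rw [le_div_iff₀ hQ0]; exact hqlo.le
    rw [kernelExt, max_eq_right h1, min_eq_right (by linarith), hμ]
    field_simp
  rw [hker]
  have hcI1 : |cI| ≤ 1 := by
    have := intervalIntegral.norm_integral_le_of_norm_le_const (f := fun x : ℝ => 1 / (1 + x ^ 2))
      (a := α) (b := β) (C := 1) (fun x _ => abs_inv_one_add_sq_le x)
    rw [Real.norm_eq_abs, abs_of_nonneg (sub_nonneg.2 hαβ)] at this
    linarith
  have hY1 : |Y - cI / η| ≤ 3 + L := by
    have e : Y - cI / η = (η * Y - cI) / η := by field_simp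
    rw [e, abs_div, abs_of_pos hη0, div_le_iff₀ hη0]
    refine hY.trans ?_
    rw [mul_comm]
    exact mul_le_mul_of_nonneg_right (by linarith) hη0.le
  have hYb : |Y| ≤ q * (4 + L) := by
    have h1 : |cI / η| ≤ q := by
      rw [abs_div, abs_of_pos hη0, hη, div_div_eq_mul_div, div_le_iff₀ hL0]
      nlinarith
    have h2 : |Y| ≤ |Y - cI / η| + |cI / η| := by
      simpa using abs_add_le (Y - cI / η) (cI / η)
    nlinarith
  have hlog : |-Real.log μ| ≤ lam⁻¹ := by
    have hμ0 := hl.trans_le hμl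
    rw [abs_of_nonneg (neg_nonneg.2 (Real.log_nonpos hμ0.le hμ1)), ← Real.log_inv]
    refine (Real.log_le_sub_one_of_pos (by positivity)).trans ?_
    have := inv_anti₀ hl hμl
    linarith
  have hmain : |(Nat.totient q : ℝ) / (q : ℝ) ^ 2 * (Y * (1 / q * X)) -
      (Nat.totient q : ℝ) / q * (1 / q * -Real.log μ) * (cI / L)| ≤
      lam⁻¹ ^ 2 * (4 * lam⁻¹ ^ 2 * (4 + L) + lam⁻¹ * (3 + L)) * (1 / (Q : ℝ) ^ 2) := by
    have e : (Nat.totient q : ℝ) / (q : ℝ) ^ 2 * (Y * (1 / q * X)) -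
      (Nat.totient q : ℝ) / q * (1 / q * -Real.log μ) * (cI / L) =
      (Nat.totient q : ℝ) / (q : ℝ) ^ 3 * ((X - -Real.log μ) * Y + -Real.log μ * (Y - cI / η)) := by
      rw [hη]
      field_simp
      ring
    have h1 : |(Nat.totient q : ℝ) / (q : ℝ) ^ 3| ≤ 1 / (lam * Q) ^ 2 := by
      rw [abs_of_nonneg (by positivity)]
      have ht : (Nat.totient q : ℝ) ≤ q := by exact_mod_cast Nat.totient_le q
      calc _ ≤ (q : ℝ) / (q : ℝ) ^ 3 := by gcongr
        _ = 1 / (q : ℝ) ^ 2 := by field_simp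
        _ ≤ _ := by gcongr
    rw [e, abs_mul]
    calc _ ≤ 1 / (lam * Q) ^ 2 * (4 * lam⁻¹ ^ 2 / Q * (q * (4 + L)) + lam⁻¹ * (3 + L)) := by
          gcongr
          refine (abs_add_le _ _).trans ?_
          rw [abs_mul, abs_mul]
          gcongr
      _ ≤ 1 / (lam * Q) ^ 2 * (4 * lam⁻¹ ^ 2 / Q * (Q * (4 + L)) + lam⁻¹ * (3 + L)) := by
          gcongr
      _ = _ := by
          rw [← mul_assoc (4 * lam⁻¹ ^ 2 / (Q : ℝ)), div_mul_cancel₀ _ hQ0.ne', mul_pow,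
            ← one_div_mul_one_div, inv_pow, one_div (lam ^ 2)]
          ring
  have hp2 : 1 / (Q : ℝ) ^ 2 ≤ (Q : ℝ) ^ (-(7 / 6) : ℝ) := by
    rw [one_div, ← Real.rpow_natCast, ← Real.rpow_neg hQ0.le]
    exact Real.rpow_le_rpow_of_exponent_le hQ1 (by norm_num)
  have hp1 : C * (1 * (1 / (lam * Q) ^ 2)) * (Q : ℝ) ^ (5 / 6 : ℝ) =
      C * lam⁻¹ ^ 2 * (Q : ℝ) ^ (-(7 / 6) : ℝ) := by
    have : (Q : ℝ) ^ (-(7 / 6) : ℝ) = (Q : ℝ) ^ (5 / 6 : ℝ) * (1 / (Q : ℝ) ^ 2) := by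
      rw [one_div, ← Real.rpow_natCast, ← Real.rpow_neg hQ0.le, ← Real.rpow_add hQ0]
      norm_num
    rw [this, mul_pow, ← one_div_mul_one_div, inv_pow, one_div (lam ^ 2)]
    ring
  rw [hp1] at hm
  refine (abs_sub_le _ _ _).trans ((add_le_add hm hmain).trans ?_)
  rw [add_mul]
  gcongr

theorem exists_abs_sum_congSum_sub_le {L : ℕ} (hL : 0 < L) {lam : ℝ}
    (hlam : lam ∈ Set.Ioc (0 : ℝ) 1) :
    ∃ C, 0 < C ∧ ∀ Q : ℕ, 0 < Q → ∀ u : ℤ, IsUnit u →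
      ∀ α β : ℝ, 0 ≤ α → α ≤ β → β ≤ 1 →
      |∑ q ∈ Finset.Ioc ⌊lam * Q⌋₊ Q, congSum L u α β lam Q q -
        (∫ x in α..β, 1 / (1 + x ^ 2)) * (Cconst L / L) * I1 lam| ≤
        C * (Q : ℝ) ^ (-(1 / 6) : ℝ) := by
  obtain ⟨C, hC, h⟩ := exists_abs_congSum_sub_le hL hlam
  obtain ⟨C', hC', h'⟩ := exists_sum_coprime_totient_sub_le hL (abs_kernelExt_sub_le hlam)
    (abs_kernelExt_le hlam) hlam
  rw [integral_kernelExt hlam] at h'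
  have hL1 : (1 : ℝ) ≤ L := by exact_mod_cast hL
  refine ⟨C + C', by positivity, fun Q hQ u hu α β hα hαβ hβ => ?_⟩
  have hQ1 : (1 : ℝ) ≤ Q := by exact_mod_cast hQ
  have hQ0 : (0 : ℝ) < Q := by linarith
  set cI := ∫ x in α..β, 1 / (1 + x ^ 2) with hcI
  have hcI1 : |cI / L| ≤ 1 := by
    have := intervalIntegral.norm_integral_le_of_norm_le_const (f := fun x : ℝ => 1 / (1 + x ^ 2))
      (a := α) (b := β) (C := 1) (fun x _ => abs_inv_one_add_sq_le x)
    rw [Real.norm_eq_abs, abs_of_nonneg (sub_nonneg.2 hαβ)] at this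
    rw [abs_div, Nat.abs_cast, div_le_one (by linarith)]
    linarith
  set M : ℕ → ℝ := fun q => (if q.Coprime L then (Nat.totient q : ℝ) / q else 0) *
        (1 / Q * kernelExt lam (q / Q)) with hM
  have e1 : |∑ q ∈ Finset.Ioc ⌊lam * Q⌋₊ Q, congSum L u α β lam Q q -
      (∑ q ∈ Finset.Ioc ⌊lam * Q⌋₊ Q, M q) * (cI / L)| ≤ C * (Q : ℝ) ^ (-(1 / 6) : ℝ) := by
    rw [Finset.sum_mul, ← Finset.sum_sub_distrib]
    refine (Finset.abs_sum_le_sum_abs _ _).trans ((Finset.sum_le_sum fun q hq =>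
      h Q q hQ hq u hu α β hα hαβ hβ).trans ?_)
    rw [Finset.sum_const, nsmul_eq_mul, Nat.card_Ioc]
    have h1 : ((Q - ⌊lam * Q⌋₊ : ℕ) : ℝ) ≤ Q := by exact_mod_cast Nat.sub_le _ _
    calc _ ≤ (Q : ℝ) * (C * (Q : ℝ) ^ (-(7 / 6) : ℝ)) := by gcongr
      _ = C * ((Q : ℝ) ^ (-(7 / 6) : ℝ) * Q) := by ring
      _ = _ := by
        rw [← Real.rpow_add_one hQ0.ne']
        norm_num
  have e2 : |(∑ q ∈ Finset.Ioc ⌊lam * Q⌋₊ Q, M q) * (cI / L) -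
      cI * (Cconst L / L) * I1 lam| ≤ C' * (Q : ℝ) ^ (-(1 / 6) : ℝ) := by
    have e : (∑ q ∈ Finset.Ioc ⌊lam * Q⌋₊ Q, M q) * (cI / L) - cI * (Cconst L / L) * I1 lam =
      (∑ q ∈ Finset.Ioc ⌊lam * Q⌋₊ Q, M q - Cconst L * I1 lam) * (cI / L) := by ring
    rw [e, abs_mul]
    refine (mul_le_of_le_one_right (abs_nonneg _) hcI1).trans ((h' Q hQ).trans ?_)
    exact mul_le_mul_of_nonneg_left (Real.rpow_le_rpow_of_exponent_le hQ1 (by norm_num)) hC'.le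
  rw [add_mul]
  exact (abs_sub_le _ _ _).trans (add_le_add e1 e2)

theorem ConsecFarey.det_eq_one {Q : ℕ} {γ γ' : ℚ} (h : ConsecFarey Q γ γ') :
    γ'.num * γ.den - γ.num * γ'.den = 1 ∧ Q < γ.den + γ'.den := by
  obtain ⟨⟨h1, h2, h3⟩, ⟨h4, h5, h6⟩, h7, h8⟩ := h
  set q := γ.den with hq
  set a := γ.num with ha
  have hq0 : 0 < (q : ℤ) := by exact_mod_cast γ.den_pos
  have hq0' : 0 < (γ'.den : ℤ) := by exact_mod_cast γ'.den_pos
  have ha0 : 0 < a := Rat.num_pos.2 h1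
  have hco : IsCoprime a (q : ℤ) := by
    rw [Int.isCoprime_iff_nat_coprime]
    simpa using γ.reduced
  obtain ⟨x, y, hxy⟩ := hco
  -- `b` is the residue of `-x` in the window `(Q - q, Q]`
  set b : ℤ := Q - (Q + x) % q with hb
  have hb1 := Int.emod_nonneg (Q + x) hq0.ne'
  have hb2 := Int.emod_lt_of_pos (Q + x) hq0
  have hqQ : (q : ℤ) ≤ Q := by exact_mod_cast h3
  have hb0 : 0 < b := by omega
  have hdvd : (q : ℤ) ∣ a * b + 1 := by
    have e := Int.emod_add_mul_ediv (Q + x) q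
    refine ⟨a * ((Q + x) / q) + y, ?_⟩
    rw [hb]
    linear_combination (-a) * e - hxy
  obtain ⟨c, hc⟩ := hdvd
  have hc0 : 0 < c := by
    by_contra hcon
    nlinarith [mul_pos ha0 hb0]
  have hcob : IsCoprime c b := ⟨q, -a, by linear_combination -hc⟩
  have hnum : ((c : ℚ) / (b : ℚ)).num = c := Rat.num_div_eq_of_coprime hb0 (by
    rwa [← Int.isCoprime_iff_nat_coprime])
  have hden : ((((c : ℚ) / (b : ℚ)).den : ℕ) : ℤ) = b := Rat.den_div_eq_of_coprime hb0 (by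
    rwa [← Int.isCoprime_iff_nat_coprime])
  set z : ℚ := (c : ℚ) / (b : ℚ) with hz
  have hz0 : 0 < z := by positivity
  have hγz : γ < z := by
    rw [Rat.lt_iff, hnum, hden]
    linarith
  rcases lt_trichotomy z γ' with hlt | heq | hgt
  · refine absurd ⟨hγz, hlt⟩ (h8 z ⟨hz0, hlt.le.trans h5, ?_⟩)
    have : (z.den : ℤ) ≤ Q := by rw [hden]; omega
    exact_mod_cast this
  · rw [← heq, hnum]
    constructor
    · rw [hden]; linarith
    · have : (Q : ℤ) < q + z.den := by rw [hden]; omega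
      exact_mod_cast this
  · exfalso
    rw [Rat.lt_iff] at h7 hgt
    rw [← hq, ← ha] at h7
    rw [hnum, hden] at hgt
    have e : (γ'.den : ℤ) = b * (γ'.num * q - a * γ'.den) + q * (c * γ'.den - γ'.num * b) := by
      linear_combination (γ'.den : ℤ) * hc
    have h6' : (γ'.den : ℤ) ≤ Q := by exact_mod_cast h6
    have i1 : b ≤ b * (γ'.num * q - a * γ'.den) := le_mul_of_one_le_right hb0.le (by omega)
    have i2 : (q : ℤ) ≤ q * (c * γ'.den - γ'.num * b) := le_mul_of_one_le_right hq0.le (by omega)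
    omega

theorem consecFarey_of_det_eq_one {Q : ℕ} {γ γ' : ℚ} (h : γ ∈ FareyQ Q) (h' : γ' ∈ FareyQ Q)
    (hdet : γ'.num * γ.den - γ.num * γ'.den = 1) (hQ : Q < γ.den + γ'.den) :
    ConsecFarey Q γ γ' := by
  refine ⟨h, h', ?_, ?_⟩
  · rw [Rat.lt_iff]; omega
  · rintro z ⟨_, _, hz⟩ ⟨h1, h2⟩
    rw [Rat.lt_iff] at h1 h2
    have hq0 : 0 < (γ.den : ℤ) := by exact_mod_cast γ.den_pos
    have hq0' : 0 < (γ'.den : ℤ) := by exact_mod_cast γ'.den_pos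
    have e : (z.den : ℤ) = γ.den * (γ'.num * z.den - z.num * γ'.den) +
        γ'.den * (z.num * γ.den - γ.num * z.den) := by
      linear_combination (-z.den : ℤ) * hdet
    have i1 : (γ.den : ℤ) ≤ γ.den * (γ'.num * z.den - z.num * γ'.den) :=
      le_mul_of_one_le_right hq0.le (by omega)
    have i2 : (γ'.den : ℤ) ≤ γ'.den * (z.num * γ.den - γ.num * z.den) :=
      le_mul_of_one_le_right hq0'.le (by omega)
    omega

theorem exists_consecFarey {Q : ℕ} {a q a' q' : ℤ} (ha : 0 < a) (haq : a ≤ q) (hq : q ≤ Q)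
    (ha' : 0 < a') (haq' : a' ≤ q') (hq' : q' ≤ Q) (hdet : a' * q - a * q' = 1)
    (hQ : Q < q + q') :
    ∃ γ γ' : ℚ, ConsecFarey Q γ γ' ∧ γ.num = a ∧ (γ.den : ℤ) = q ∧ γ'.num = a' ∧
      (γ'.den : ℤ) = q' := by
  have hq0 : 0 < q := by omega
  have hq0' : 0 < q' := by omega
  have hco : IsCoprime a q := ⟨-q', a', by linarith⟩
  have hco' : IsCoprime a' q' := ⟨q, -a, by linarith⟩
  rw [Int.isCoprime_iff_nat_coprime] at hco hco'
  have n1 := Rat.num_div_eq_of_coprime hq0 hco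
  have n2 := Rat.num_div_eq_of_coprime hq0' hco'
  have d1 := Rat.den_div_eq_of_coprime hq0 hco
  have d2 := Rat.den_div_eq_of_coprime hq0' hco'
  refine ⟨(a : ℚ) / q, (a' : ℚ) / q', consecFarey_of_det_eq_one ⟨by positivity, ?_, ?_⟩
    ⟨by positivity, ?_, ?_⟩ ?_ ?_, n1, d1, n2, d2⟩
  · rw [div_le_one (by positivity)]; exact_mod_cast haq
  · zify; rw [d1]; exact hq
  · rw [div_le_one (by positivity)]; exact_mod_cast haq'
  · zify; rw [d2]; exact hq'
  · rw [n1, n2, d1, d2]; exact hdet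
  · zify; rw [d1, d2]; exact hQ

theorem ConsecFarey.right_unique {Q : ℕ} {γ x y : ℚ} (hx : ConsecFarey Q γ x)
    (hy : ConsecFarey Q γ y) : x = y := by
  rcases lt_trichotomy x y with h | h | h
  · exact absurd ⟨hx.2.2.1, h⟩ (hy.2.2.2 x hx.2.1)
  · exact h
  · exact absurd ⟨hy.2.2.1, h⟩ (hx.2.2.2 y hy.2.1)

theorem ConsecFarey.left_unique {Q : ℕ} {γ x y : ℚ} (hx : ConsecFarey Q x γ)
    (hy : ConsecFarey Q y γ) : x = y := by
  rcases lt_trichotomy x y with h | h | h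
  · exact absurd ⟨h, hy.2.2.1⟩ (hx.2.2.2 y hy.1)
  · exact h
  · exact absurd ⟨h, hx.2.2.1⟩ (hy.2.2.2 x hx.1)

theorem ConsecFarey.not_both_mem {Q l : ℕ} (hl : 2 ≤ l) {γ γ' : ℚ} (h : ConsecFarey Q γ γ') :
    ¬ (γ ∈ FareyCong l ∧ γ' ∈ FareyCong l) := by
  rintro ⟨⟨_, _, h1⟩, _, _, h2⟩
  have h3 : (l : ℤ) ∣ 1 := by
    rw [← h.det_eq_one.1]
    have e : γ'.num * γ.den - γ.num * γ'.den =
        ((γ.den : ℤ) - γ.num) * γ'.den - (γ'.den - γ'.num) * γ.den := by ring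
    rw [e]
    exact dvd_sub (h1.mul_right _) (h2.mul_right _)
  have := Int.le_of_dvd one_pos h3
  omega

theorem finite_fareyQ (Q : ℕ) : (FareyQ Q).Finite := by
  refine Set.Finite.of_finite_image (f := fun x : ℚ => ((x.num, x.den) : ℤ × ℕ))
    (((Set.finite_Icc (0 : ℤ) Q).prod (Set.finite_Icc 0 Q)).subset ?_) ?_
  · rintro _ ⟨x, ⟨h1, h2, h3⟩, rfl⟩
    have h4 : x.num ≤ x.den := Rat.num_le_denom_iff.2 h2
    refine ⟨⟨(Rat.num_pos.2 h1).le, ?_⟩, Nat.zero_le _, h3⟩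
    have : (x.den : ℤ) ≤ Q := by exact_mod_cast h3
    exact h4.trans this
  · intro x _ y _ h
    simp only [Prod.mk.injEq] at h
    exact Rat.ext h.1 h.2

theorem finite_fareyPairs (Q : ℕ) (lam : ℝ) : {p : ℚ × ℚ | ConsecFarey Q p.1 p.2 ∧
    lam * Q < (min p.1.den p.2.den : ℝ)}.Finite :=
  ((finite_fareyQ Q).prod (finite_fareyQ Q)).subset fun _ hp => ⟨hp.1.1, hp.1.2.1⟩

/-- The pairs of consecutive Farey fractions with both denominators larger than `λ Q`. -/
noncomputable def fareyPairs (Q : ℕ) (lam : ℝ) : Finset (ℚ × ℚ) := (finite_fareyPairs Q lam).toFinset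

theorem mem_fareyPairs {Q : ℕ} {lam : ℝ} {p : ℚ × ℚ} : p ∈ fareyPairs Q lam ↔
    ConsecFarey Q p.1 p.2 ∧ lam * Q < p.1.den ∧ lam * Q < p.2.den := by
  rw [fareyPairs, Set.Finite.mem_toFinset, Set.mem_ofPred_eq, lt_min_iff]

theorem ratCast_mem_Ioc_iff {α β : ℝ} {x : ℚ} :
    (x : ℝ) ∈ Set.Ioc α β ↔ x.num ∈ Finset.Ioc ⌊α * x.den⌋ ⌊β * x.den⌋ := by
  have h0 : (0 : ℝ) < x.den := by exact_mod_cast x.den_pos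
  rw [Finset.mem_Ioc, Int.floor_lt, Int.le_floor, Set.mem_Ioc, Rat.cast_def, lt_div_iff₀ h0,
    div_le_iff₀ h0]

theorem mem_Ioc_floor_max_iff {lam : ℝ} {Q q : ℕ} (hQ : 0 < Q) {b : ℤ} :
    b ∈ Finset.Ioc ⌊max lam (1 - (q : ℝ) / Q) * Q⌋ (Q : ℤ) ↔
      lam * Q < b ∧ (Q : ℤ) < q + b ∧ b ≤ Q := by
  have hQ0 : (0 : ℝ) < Q := by exact_mod_cast hQ
  rw [Finset.mem_Ioc, Int.floor_lt, max_mul_of_nonneg _ _ hQ0.le, max_lt_iff, and_assoc]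
  have e : (1 - (q : ℝ) / Q) * Q = Q - q := by field_simp
  rw [e, sub_lt_iff_lt_add']
  norm_cast

open Classical in
theorem sum_congSum_eq {L : ℕ} {u : ℤ} {α β lam : ℝ} {Q : ℕ} :
    ∑ q ∈ Finset.Ioc ⌊lam * Q⌋₊ Q, congSum L u α β lam Q q =
      ∑ t ∈ ((Finset.Ioc ⌊lam * Q⌋₊ Q).sigma fun q => Finset.Ioc ⌊α * q⌋ ⌊β * q⌋ ×ˢ
        Finset.Ioc ⌊max lam (1 - (q : ℝ) / Q) * Q⌋ (Q : ℤ)).filter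
          (fun t : Σ _ : ℕ, ℤ × ℤ => (L : ℤ) ∣ t.1 - t.2.1 ∧ (t.1 : ℤ) ∣ t.2.1 * t.2.2 - u),
        1 / (1 + ((t.2.1 : ℝ) / t.1) ^ 2) * (1 / (t.1 * t.2.2)) := by
  rw [Finset.sum_filter, Finset.sum_sigma]
  refine Finset.sum_congr rfl fun q _ => ?_
  rw [congSum, Finset.sum_product]

open Classical in
theorem sum_left_fareyPairs_eq {L : ℕ} {α β lam : ℝ} {Q : ℕ} (hlamQ : 1 ≤ lam * Q)
    (hα : 0 ≤ α) (hβ : β ≤ 1) :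
    ∑ p ∈ (fareyPairs Q lam).filter (fun p => (p.1 : ℝ) ∈ Set.Ioc α β ∧ p.1 ∈ FareyCong L),
      1 / ((p.1.den : ℝ) * p.2.den * (1 + (p.1 : ℝ) ^ 2)) =
    ∑ q ∈ Finset.Ioc ⌊lam * Q⌋₊ Q, congSum L (-1) α β lam Q q := by
  have hQ : 0 < Q := by
    rcases Nat.eq_zero_or_pos Q with rfl | h
    · norm_num at hlamQ
    · exact h
  rw [sum_congSum_eq]
  refine Finset.sum_bij (fun p _ => ⟨p.1.den, (p.1.num, (p.2.den : ℤ))⟩) ?_ ?_ ?_ ?_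
  · rintro ⟨x, y⟩ hp
    simp only [Finset.mem_filter, mem_fareyPairs, ratCast_mem_Ioc_iff] at hp
    obtain ⟨⟨h1, h2, h3⟩, h4, h5⟩ := hp
    simp only [Finset.mem_filter, Finset.mem_sigma, Finset.mem_product, mem_Ioc_floor_max_iff hQ]
    have hd := h1.det_eq_one
    refine ⟨⟨?_, h4, by exact_mod_cast h3, by exact_mod_cast hd.2, by exact_mod_cast h1.2.1.2.2⟩,
      h5.2.2, y.num, by linarith [hd.1]⟩
    rw [Finset.mem_Ioc, Nat.floor_lt (by linarith)]
    exact ⟨h2, h1.1.2.2⟩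
  · rintro ⟨x, y⟩ hp ⟨x', y'⟩ hp' h
    simp only [Finset.mem_filter, mem_fareyPairs] at hp hp'
    simp only [Sigma.mk.injEq, heq_eq_eq, Prod.mk.injEq] at h
    have hx : x = x' := Rat.ext h.2.1 h.1
    subst hx
    rw [hp.1.1.right_unique hp'.1.1]
  · rintro ⟨q, a, b⟩ ht
    simp only [Finset.mem_filter, Finset.mem_sigma, Finset.mem_product,
      mem_Ioc_floor_max_iff hQ] at ht
    obtain ⟨⟨h1, h2, h3, h4, h5⟩, h6, c, hc⟩ := ht
    rw [Finset.mem_Ioc, Nat.floor_lt (by linarith)] at h1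
    have hq1 : 1 < q := by exact_mod_cast hlamQ.trans_lt h1.1
    have hb1 : 1 < b := by exact_mod_cast hlamQ.trans_lt h3
    have h2' := h2
    rw [Finset.mem_Ioc, Int.floor_lt, Int.le_floor] at h2
    have hq0 : (0 : ℝ) < q := by exact_mod_cast (zero_lt_one.trans hq1)
    have ha0 : 0 < a := by
      have : (0 : ℝ) < a := lt_of_le_of_lt (by positivity) h2.1
      exact_mod_cast this
    have haq : a ≤ q := by
      have : (a : ℝ) ≤ q := h2.2.trans (mul_le_of_le_one_left hq0.le hβ)
      exact_mod_cast this
    have haq' : a < q := by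
      refine lt_of_le_of_ne haq fun h => ?_
      have : (q : ℤ) ∣ 1 := ⟨c - b, by rw [h] at hc; linarith⟩
      have := Int.le_of_dvd one_pos this
      omega
    have hc0 : 0 < c := by
      by_contra hcon
      nlinarith
    have hcb : c ≤ b := by
      by_contra hcon
      nlinarith
    obtain ⟨x, y, hxy, r1, r2, r3, r4⟩ := exists_consecFarey (Q := Q) (a := a) (q := q) (a' := c)
      (q' := b) ha0 haq (by exact_mod_cast h1.2) hc0 hcb h5 (by linarith) h4
    have r2' : x.den = q := by exact_mod_cast r2
    refine ⟨(x, y), ?_, by simp only [r1, r2', r4]⟩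
    simp only [Finset.mem_filter, mem_fareyPairs, ratCast_mem_Ioc_iff, r1, r2']
    refine ⟨⟨hxy, h1.1, ?_⟩, h2', hxy.1.1, hxy.1.2.1, ?_⟩
    · rw [← r4] at h3; exact_mod_cast h3
    · rw [r1, r2]; exact h6
  · rintro ⟨x, y⟩ _
    simp only [Rat.cast_def x]
    push_cast
    rw [one_div_mul_one_div, mul_comm]

open Classical in
theorem sum_right_fareyPairs_eq {L : ℕ} {α β lam : ℝ} {Q : ℕ} (hlamQ : 1 ≤ lam * Q)
    (hα : 0 ≤ α) (hβ : β ≤ 1) :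
    ∑ p ∈ (fareyPairs Q lam).filter (fun p => (p.2 : ℝ) ∈ Set.Ioc α β ∧ p.2 ∈ FareyCong L),
      1 / ((p.1.den : ℝ) * p.2.den * (1 + (p.2 : ℝ) ^ 2)) =
    ∑ q ∈ Finset.Ioc ⌊lam * Q⌋₊ Q, congSum L 1 α β lam Q q := by
  have hQ : 0 < Q := by
    rcases Nat.eq_zero_or_pos Q with rfl | h
    · norm_num at hlamQ
    · exact h
  rw [sum_congSum_eq]
  refine Finset.sum_bij (fun p _ => ⟨p.2.den, (p.2.num, (p.1.den : ℤ))⟩) ?_ ?_ ?_ ?_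
  · rintro ⟨x, y⟩ hp
    simp only [Finset.mem_filter, mem_fareyPairs, ratCast_mem_Ioc_iff] at hp
    obtain ⟨⟨h1, h2, h3⟩, h4, h5⟩ := hp
    simp only [Finset.mem_filter, Finset.mem_sigma, Finset.mem_product, mem_Ioc_floor_max_iff hQ]
    have hd := h1.det_eq_one
    refine ⟨⟨?_, h4, by exact_mod_cast h2, ?_, by exact_mod_cast h1.1.2.2⟩,
      h5.2.2, x.num, by linarith [hd.1]⟩
    · rw [Finset.mem_Ioc, Nat.floor_lt (by linarith)]
      exact ⟨h3, h1.2.1.2.2⟩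
    · rw [add_comm]; exact_mod_cast hd.2
  · rintro ⟨x, y⟩ hp ⟨x', y'⟩ hp' h
    simp only [Finset.mem_filter, mem_fareyPairs] at hp hp'
    simp only [Sigma.mk.injEq, heq_eq_eq, Prod.mk.injEq] at h
    have hy : y = y' := Rat.ext h.2.1 h.1
    subst hy
    rw [hp.1.1.left_unique hp'.1.1]
  · rintro ⟨q, a, b⟩ ht
    simp only [Finset.mem_filter, Finset.mem_sigma, Finset.mem_product,
      mem_Ioc_floor_max_iff hQ] at ht
    obtain ⟨⟨h1, h2, h3, h4, h5⟩, h6, c, hc⟩ := ht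
    rw [Finset.mem_Ioc, Nat.floor_lt (by linarith)] at h1
    have hq1 : 1 < q := by exact_mod_cast hlamQ.trans_lt h1.1
    have hb1 : 1 < b := by exact_mod_cast hlamQ.trans_lt h3
    have h2' := h2
    rw [Finset.mem_Ioc, Int.floor_lt, Int.le_floor] at h2
    have hq0 : (0 : ℝ) < q := by exact_mod_cast (zero_lt_one.trans hq1)
    have ha0 : 0 < a := by
      have : (0 : ℝ) < a := lt_of_le_of_lt (by positivity) h2.1
      exact_mod_cast this
    have haq : a ≤ q := by
      have : (a : ℝ) ≤ q := h2.2.trans (mul_le_of_le_one_left hq0.le hβ)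
      exact_mod_cast this
    have hq1' : (1 : ℤ) < q := by exact_mod_cast hq1
    have hc0 : 0 < c := by
      by_contra hcon
      nlinarith
    have hcb : c ≤ b := by
      by_contra hcon
      nlinarith
    obtain ⟨x, y, hxy, r1, r2, r3, r4⟩ := exists_consecFarey (Q := Q) (a := c) (q := b) (a' := a)
      (q' := q) hc0 hcb h5 ha0 haq (by exact_mod_cast h1.2) (by linarith) (by linarith)
    have r4' : y.den = q := by exact_mod_cast r4
    refine ⟨(x, y), ?_, by simp only [r3, r4', r2]⟩
    simp only [Finset.mem_filter, mem_fareyPairs, ratCast_mem_Ioc_iff, r3, r4']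
    refine ⟨⟨hxy, ?_, h1.1⟩, h2', hxy.2.1.1, hxy.2.1.2.1, ?_⟩
    · rw [← r2] at h3; exact_mod_cast h3
    · rw [r3, r4]; exact h6
  · rintro ⟨x, y⟩ _
    simp only [Rat.cast_def y]
    push_cast
    rw [one_div_mul_one_div, mul_comm, mul_comm (x.den : ℝ)]

theorem card_fareyPairs_le (Q : ℕ) (lam : ℝ) : (fareyPairs Q lam).card ≤ Q ^ 2 := by
  have h : (fareyPairs Q lam).card ≤ (Finset.Ioc 0 Q ×ˢ Finset.Ioc (0 : ℤ) Q).card := by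
    refine Finset.card_le_card_of_injOn (fun p => (p.1.den, p.1.num)) ?_ ?_
    · rintro ⟨x, y⟩ hp
      obtain ⟨⟨⟨h1, h2, h3⟩, _⟩, _⟩ := mem_fareyPairs.1 hp
      have h4 : x.num ≤ x.den := Rat.num_le_denom_iff.2 h2
      have h5 : 0 < x.num := Rat.num_pos.2 h1
      have h6 := x.den_pos
      simp only [Finset.coe_product, Finset.coe_Ioc, Set.mem_prod, Set.mem_Ioc]
      simp only at h3
      omega
    · rintro ⟨x, y⟩ hp ⟨x', y'⟩ hp' h
      simp only [Finset.mem_coe, mem_fareyPairs] at hp hp'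
      simp only [Prod.mk.injEq] at h
      have hx : x = x' := Rat.ext h.2 h.1
      subst hx
      rw [hp.1.right_unique hp'.1]
  rwa [Finset.card_product, Nat.card_Ioc, Int.card_Ioc, Nat.sub_zero, sub_zero, Int.toNat_natCast,
    ← pow_two] at h

open Classical in
theorem card_filter_straddle_le (Q : ℕ) (lam t : ℝ) :
    ((fareyPairs Q lam).filter fun p => (p.1 : ℝ) ≤ t ∧ t ≤ p.2).card ≤ 2 := by
  have h1 : ((fareyPairs Q lam).filter fun p => (p.1 : ℝ) = t).card ≤ 1 := by
    rw [Finset.card_le_one]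
    rintro ⟨x, y⟩ hp ⟨x', y'⟩ hp'
    simp only [Finset.mem_filter, mem_fareyPairs] at hp hp'
    have hx : x = x' := by exact_mod_cast hp.2.trans hp'.2.symm
    subst hx
    rw [hp.1.1.right_unique hp'.1.1]
  have h2 : ((fareyPairs Q lam).filter fun p => (p.1 : ℝ) < t ∧ t ≤ p.2).card ≤ 1 := by
    rw [Finset.card_le_one]
    rintro ⟨x, y⟩ hp ⟨x', y'⟩ hp'
    simp only [Finset.mem_filter, mem_fareyPairs] at hp hp'
    obtain ⟨⟨h1, -⟩, h2, h3⟩ := hp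
    obtain ⟨⟨h1', -⟩, h2', h3'⟩ := hp'
    have i1 : x < y' := by exact_mod_cast h2.trans_le h3'
    have i2 : x' < y := by exact_mod_cast h2'.trans_le h3
    have hx : x = x' := by
      rcases lt_trichotomy x x' with h | h | h
      · exact absurd ⟨h, i2⟩ (h1.2.2.2 x' h1'.1)
      · exact h
      · exact absurd ⟨h, i1⟩ (h1'.2.2.2 x h1.1)
    subst hx
    rw [h1.right_unique h1']
  refine (Finset.card_le_card (t := ((fareyPairs Q lam).filter fun p => (p.1 : ℝ) = t) ∪
    ((fareyPairs Q lam).filter fun p => (p.1 : ℝ) < t ∧ t ≤ p.2)) ?_).trans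
    ((Finset.card_union_le _ _).trans (add_le_add h1 h2))
  intro p hp
  rw [Finset.mem_filter] at hp
  rw [Finset.mem_union, Finset.mem_filter, Finset.mem_filter]
  rcases hp.2.1.eq_or_lt with h | h
  · exact Or.inl ⟨hp.1, h⟩
  · exact Or.inr ⟨hp.1, h, hp.2.2⟩

open Classical in
theorem Asum_eq_sum (l Q : ℕ) (I : Set ℝ) (lam : ℝ) :
    Asum l Q I lam = ∑ p ∈ (fareyPairs Q lam).filter (fun p => (p.1 : ℝ) ∈ I ∧ (p.2 : ℝ) ∈ I ∧
      p.1 ∉ FareyCong l ∧ p.2 ∉ FareyCong l),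
        1 / ((p.1.den : ℝ) * p.2.den * (1 + (p.1 : ℝ) ^ 2)) := by
  rw [← Finset.tsum_subtype']
  refine tsum_congr_set_coe (fun p : ℚ × ℚ =>
    1 / ((p.1.den : ℝ) * p.2.den * (1 + (p.1 : ℝ) ^ 2))) (s := {p | _}) ?_
  ext p
  rw [Finset.mem_coe, Finset.mem_filter, mem_fareyPairs, Set.mem_ofPred_eq, lt_min_iff]
  tauto

theorem ConsecFarey.sub_eq {Q : ℕ} {x y : ℚ} (h : ConsecFarey Q x y) :
    (y : ℝ) - x = 1 / ((x.den : ℝ) * y.den) := by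
  have h0 : (0 : ℝ) < x.den := by exact_mod_cast x.den_pos
  have h1 : (0 : ℝ) < y.den := by exact_mod_cast y.den_pos
  have h2 : (y.num : ℝ) * x.den - x.num * y.den = 1 := by exact_mod_cast h.det_eq_one.1
  rw [Rat.cast_def x, Rat.cast_def y]
  field_simp
  linarith

theorem weight_nonneg (p : ℚ × ℚ) (x : ℝ) : 0 ≤ 1 / ((p.1.den : ℝ) * p.2.den * (1 + x ^ 2)) := by
  positivity

theorem weight_le {Q : ℕ} {lam : ℝ} {p : ℚ × ℚ} (hp : p ∈ fareyPairs Q lam)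
    (h0 : 0 < lam * Q) (x : ℝ) :
    1 / ((p.1.den : ℝ) * p.2.den * (1 + x ^ 2)) ≤ 1 / (lam * Q) ^ 2 := by
  obtain ⟨-, h1, h2⟩ := mem_fareyPairs.1 hp
  refine one_div_le_one_div_of_le (by positivity) ?_
  have h3 : (lam * Q) ^ 2 ≤ p.1.den * p.2.den := by
    rw [pow_two]; exact mul_le_mul h1.le h2.le h0.le (h0.trans h1).le
  exact h3.trans (le_mul_of_one_le_right (by positivity) (by nlinarith [sq_nonneg x]))

theorem abs_weight_sub_le {Q : ℕ} {lam : ℝ} {p : ℚ × ℚ} (hp : p ∈ fareyPairs Q lam)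
    (h0 : 0 < lam * Q) :
    |1 / ((p.1.den : ℝ) * p.2.den * (1 + (p.2 : ℝ) ^ 2)) -
      1 / ((p.1.den : ℝ) * p.2.den * (1 + (p.1 : ℝ) ^ 2))| ≤ (1 / (lam * Q) ^ 2) ^ 2 := by
  obtain ⟨h1, -⟩ := mem_fareyPairs.1 hp
  have h2 := weight_le hp h0 0
  have h3 := abs_inv_one_add_sq_sub_le (p.2 : ℝ) p.1
  rw [h1.sub_eq] at h3
  have e : 1 / ((p.1.den : ℝ) * p.2.den * (1 + (p.2 : ℝ) ^ 2)) -
      1 / ((p.1.den : ℝ) * p.2.den * (1 + (p.1 : ℝ) ^ 2)) = 1 / ((p.1.den : ℝ) * p.2.den) *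
      (1 / (1 + (p.2 : ℝ) ^ 2) - 1 / (1 + (p.1 : ℝ) ^ 2)) := by
    rw [mul_sub, one_div_mul_one_div, one_div_mul_one_div]
  have h4 : (0 : ℝ) ≤ 1 / ((p.1.den : ℝ) * p.2.den) := by positivity
  rw [zero_pow two_ne_zero, add_zero, mul_one] at h2
  rw [one_mul, abs_of_nonneg h4] at h3
  rw [e, abs_mul, abs_of_nonneg h4, pow_two (1 / (lam * Q) ^ 2)]
  exact mul_le_mul h2 (h3.trans h2) (abs_nonneg _) (by positivity)

open Classical in
theorem abs_Asum_sub_sums_le {l : ℕ} (hl : 2 ≤ l) {Q : ℕ} {lam : ℝ} (h0 : 0 < lam * Q)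
    {I : Set ℝ} {α β : ℝ} (h1 : Set.Ioo α β ⊆ I) (h2 : I ⊆ Set.Icc α β) :
    |Asum l Q I lam - (
      ∑ p ∈ (fareyPairs Q lam).filter (fun p => (p.1 : ℝ) ∈ Set.Ioc α β ∧ p.1 ∈ FareyCong 1),
        1 / ((p.1.den : ℝ) * p.2.den * (1 + (p.1 : ℝ) ^ 2)) -
      ∑ p ∈ (fareyPairs Q lam).filter (fun p => (p.1 : ℝ) ∈ Set.Ioc α β ∧ p.1 ∈ FareyCong l),
        1 / ((p.1.den : ℝ) * p.2.den * (1 + (p.1 : ℝ) ^ 2)) -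
      ∑ p ∈ (fareyPairs Q lam).filter (fun p => (p.2 : ℝ) ∈ Set.Ioc α β ∧ p.2 ∈ FareyCong l),
        1 / ((p.1.den : ℝ) * p.2.den * (1 + (p.2 : ℝ) ^ 2)))| ≤
      12 * (1 / (lam * Q) ^ 2) + Q ^ 2 * (1 / (lam * Q) ^ 2) ^ 2 := by
  set M := 1 / (lam * Q) ^ 2 with hM
  have hM0 : 0 ≤ M := by positivity
  rw [Asum_eq_sum]
  simp only [Finset.sum_filter]
  rw [← Finset.sum_sub_distrib, ← Finset.sum_sub_distrib, ← Finset.sum_sub_distrib]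
  have key : ∀ p ∈ fareyPairs Q lam, |(if (p.1 : ℝ) ∈ I ∧ (p.2 : ℝ) ∈ I ∧
      p.1 ∉ FareyCong l ∧ p.2 ∉ FareyCong l then
        1 / ((p.1.den : ℝ) * p.2.den * (1 + (p.1 : ℝ) ^ 2)) else 0) -
      ((if (p.1 : ℝ) ∈ Set.Ioc α β ∧ p.1 ∈ FareyCong 1 then
        1 / ((p.1.den : ℝ) * p.2.den * (1 + (p.1 : ℝ) ^ 2)) else 0) -
      (if (p.1 : ℝ) ∈ Set.Ioc α β ∧ p.1 ∈ FareyCong l then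
        1 / ((p.1.den : ℝ) * p.2.den * (1 + (p.1 : ℝ) ^ 2)) else 0) -
      (if (p.2 : ℝ) ∈ Set.Ioc α β ∧ p.2 ∈ FareyCong l then
        1 / ((p.1.den : ℝ) * p.2.den * (1 + (p.2 : ℝ) ^ 2)) else 0))| ≤
      (if (p.1 : ℝ) ≤ α ∧ α ≤ p.2 then 3 * M else 0) +
      (if (p.1 : ℝ) ≤ β ∧ β ≤ p.2 then 3 * M else 0) + M ^ 2 := by
    intro p hp
    have hF0 := weight_nonneg p p.1
    have hF0' := weight_nonneg p p.2
    have hF1 := weight_le hp h0 p.1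
    have hF1' := weight_le hp h0 p.2
    have hFF := abs_weight_sub_le hp h0
    set F := 1 / ((p.1.den : ℝ) * p.2.den * (1 + (p.1 : ℝ) ^ 2))
    set F' := 1 / ((p.1.den : ℝ) * p.2.den * (1 + (p.2 : ℝ) ^ 2))
    rw [← hM] at hF1 hF1' hFF
    obtain ⟨hc, -⟩ := mem_fareyPairs.1 hp
    have hF1mem : p.1 ∈ FareyCong 1 := ⟨hc.1.1, hc.1.2.1, by simp⟩
    have hlt : (p.1 : ℝ) < p.2 := by exact_mod_cast hc.2.2.1
    by_cases hs : ((p.1 : ℝ) ≤ α ∧ α ≤ p.2) ∨ ((p.1 : ℝ) ≤ β ∧ β ≤ p.2)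
    · have hr : 3 * M ≤ (if (p.1 : ℝ) ≤ α ∧ α ≤ p.2 then 3 * M else 0) +
          (if (p.1 : ℝ) ≤ β ∧ β ≤ p.2 then 3 * M else 0) + M ^ 2 := by
        have : 0 ≤ M ^ 2 := by positivity
        rcases hs with hs | hs
        · rw [if_pos hs]
          split_ifs <;> linarith
        · rw [if_pos hs]
          split_ifs <;> linarith
      refine le_trans ?_ hr
      rw [abs_le]
      constructor <;> (split_ifs <;> linarith)
    · rw [not_or] at hs
      rw [if_neg hs.1, if_neg hs.2, zero_add, zero_add]
      have hM2 : 0 ≤ M ^ 2 := by positivity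
      by_cases hin : α < p.1 ∧ (p.2 : ℝ) < β
      · have i1 : (p.1 : ℝ) ∈ I := h1 ⟨hin.1, hlt.trans hin.2⟩
        have i2 : (p.2 : ℝ) ∈ I := h1 ⟨hin.1.trans hlt, hin.2⟩
        have i3 : (p.1 : ℝ) ∈ Set.Ioc α β := ⟨hin.1, (hlt.trans hin.2).le⟩
        have i4 : (p.2 : ℝ) ∈ Set.Ioc α β := ⟨hin.1.trans hlt, hin.2.le⟩
        simp only [i1, i2, i3, i4, hF1mem, true_and, and_self, if_true]
        have hn := hc.not_both_mem hl
        by_cases j1 : p.1 ∈ FareyCong l <;> by_cases j2 : p.2 ∈ FareyCong l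
        · exact absurd ⟨j1, j2⟩ hn
        · simpa [j1, j2] using hM2
        · simp only [j1, j2, not_true, and_false, if_false, if_true]
          convert hFF using 2
          ring
        · simpa [j1, j2] using hM2
      · have hout : (p.2 : ℝ) < α ∨ β < p.1 := by
          by_contra hcon
          rw [not_or, not_lt, not_lt] at hcon
          have i1 : α < p.1 := by
            by_contra h
            exact hs.1 ⟨not_lt.1 h, hcon.1⟩
          have i2 : (p.2 : ℝ) < β := by
            by_contra h
            exact hs.2 ⟨hcon.2, not_lt.1 h⟩
          exact hin ⟨i1, i2⟩
        have i1 : (p.1 : ℝ) ∉ I := fun h => by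
          have := h2 h
          rcases hout with h | h <;> linarith [this.1, this.2]
        have i3 : (p.1 : ℝ) ∉ Set.Ioc α β := fun h' => by
          rcases hout with h | h <;> linarith [h'.1, h'.2]
        have i4 : (p.2 : ℝ) ∉ Set.Ioc α β := fun h' => by
          rcases hout with h | h <;> linarith [h'.1, h'.2]
        simpa [i1, i3, i4] using hM2
  refine (Finset.abs_sum_le_sum_abs _ _).trans ((Finset.sum_le_sum key).trans ?_)
  rw [Finset.sum_add_distrib, Finset.sum_add_distrib, ← Finset.sum_filter, ← Finset.sum_filter,
    Finset.sum_const, Finset.sum_const, Finset.sum_const, nsmul_eq_mul, nsmul_eq_mul, nsmul_eq_mul]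
  have c1 : (((fareyPairs Q lam).filter fun p => (p.1 : ℝ) ≤ α ∧ α ≤ p.2).card : ℝ) ≤ 2 := by
    exact_mod_cast card_filter_straddle_le Q lam α
  have c2 : (((fareyPairs Q lam).filter fun p => (p.1 : ℝ) ≤ β ∧ β ≤ p.2).card : ℝ) ≤ 2 := by
    exact_mod_cast card_filter_straddle_le Q lam β
  have c3 : ((fareyPairs Q lam).card : ℝ) ≤ Q ^ 2 := by
    exact_mod_cast card_fareyPairs_le Q lam
  have d1 := mul_le_mul_of_nonneg_right c1 (show 0 ≤ 3 * M by positivity)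
  have d2 := mul_le_mul_of_nonneg_right c2 (show 0 ≤ 3 * M by positivity)
  have d3 := mul_le_mul_of_nonneg_right c3 (show 0 ≤ M ^ 2 by positivity)
  linarith

theorem Asum_nonneg (l Q : ℕ) (I : Set ℝ) (lam : ℝ) : 0 ≤ Asum l Q I lam :=
  tsum_nonneg fun p => weight_nonneg p.1 p.1.1

theorem Asum_le (l Q : ℕ) (I : Set ℝ) (lam : ℝ) : Asum l Q I lam ≤ Q ^ 2 := by
  classical
  rw [Asum_eq_sum]
  have h : ∀ p : ℚ × ℚ, 1 / ((p.1.den : ℝ) * p.2.den * (1 + (p.1 : ℝ) ^ 2)) ≤ 1 := fun p => by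
    have h1 : (1 : ℝ) ≤ p.1.den := by exact_mod_cast p.1.den_pos
    have h2 : (1 : ℝ) ≤ p.2.den := by exact_mod_cast p.2.den_pos
    refine div_le_one_of_le₀ ?_ (by positivity)
    exact one_le_mul_of_one_le_of_one_le (one_le_mul_of_one_le_of_one_le h1 h2)
      (by nlinarith [sq_nonneg (p.1 : ℝ)])
  refine (Finset.sum_le_card_nsmul _ _ 1 fun p _ => h p).trans ?_
  rw [nsmul_eq_mul, mul_one]
  exact_mod_cast (Finset.card_filter_le _ _).trans (card_fareyPairs_le Q lam)

theorem exists_Ioo_subset_subset_Icc {I : Set ℝ} (hI : I ⊆ Set.Icc 0 1) (ho : I.OrdConnected) :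
    ∃ α β : ℝ, 0 ≤ α ∧ α ≤ β ∧ β ≤ 1 ∧ Set.Ioo α β ⊆ I ∧ I ⊆ Set.Icc α β := by
  rcases I.eq_empty_or_nonempty with rfl | hne
  · exact ⟨0, 0, le_rfl, le_rfl, zero_le_one, by simp, by simp⟩
  · have hb : BddBelow I := bddBelow_Icc.mono hI
    have ha : BddAbove I := bddAbove_Icc.mono hI
    exact ⟨sInf I, sSup I, le_csInf hne fun x hx => (hI hx).1, csInf_le_csSup hne hb ha,
      csSup_le hne fun x hx => (hI hx).2, IsConnected.Ioo_csInf_csSup_subset ⟨hne, ho.isPreconnected⟩ hb ha,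
      subset_Icc_csInf_csSup hb ha⟩

theorem setIntegral_eq_intervalIntegral {I : Set ℝ} {α β : ℝ} (hαβ : α ≤ β)
    (h1 : Set.Ioo α β ⊆ I) (h2 : I ⊆ Set.Icc α β) (f : ℝ → ℝ) :
    ∫ u in I, f u = ∫ u in α..β, f u := by
  rw [intervalIntegral.integral_of_le hαβ]
  refine setIntegral_congr_set ?_
  have e : (Set.Ioc α β : Set ℝ) =ᵐ[volume] Set.Icc α β := Ioc_ae_eq_Icc
  have e' : (Set.Ioo α β : Set ℝ) =ᵐ[volume] Set.Icc α β := Ioo_ae_eq_Icc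
  refine (Filter.EventuallyLE.antisymm ?_ ?_).trans e.symm
  · exact h2.eventuallyLE
  · exact e'.symm.le.trans h1.eventuallyLE

theorem abs_integral_inv_one_add_sq_le {α β : ℝ} (h0 : 0 ≤ α) (h1 : α ≤ β) (h2 : β ≤ 1) :
    |∫ x in α..β, 1 / (1 + x ^ 2)| ≤ 1 := by
  have h := intervalIntegral.norm_integral_le_of_norm_le_const (a := α) (b := β)
    (f := fun x : ℝ => 1 / (1 + x ^ 2)) (C := 1) fun x _ => abs_inv_one_add_sq_le x
  rw [Real.norm_eq_abs, one_mul, abs_of_nonneg (sub_nonneg.2 h1)] at h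
  linarith

theorem exists_abs_Asum_sub_le {l : ℕ} (hl : 2 ≤ l) {lam : ℝ} (hlam : lam ∈ Set.Ioc (0 : ℝ) 1) :
    ∃ C : ℝ, 0 < C ∧ ∀ Q : ℕ, 1 ≤ Q → ∀ I : Set ℝ, I ⊆ Set.Icc 0 1 → I.OrdConnected →
      |Asum l Q I lam - (∫ u in I, 1 / (1 + u ^ 2)) * Aconst l * I1 lam| ≤
        C * (Q : ℝ) ^ (-(1 / 6) : ℝ) := by
  obtain ⟨C₁, hC₁, H₁⟩ := exists_abs_sum_congSum_sub_le one_pos hlam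
  obtain ⟨C₂, hC₂, H₂⟩ := exists_abs_sum_congSum_sub_le (show 0 < l by omega) hlam
  have hl0 := hlam.1
  have hl1 : 1 ≤ lam⁻¹ := (one_le_inv₀ hl0).2 hlam.2
  refine ⟨C₁ + 2 * C₂ + 13 * lam⁻¹ ^ 4 + (lam⁻¹ ^ 2 + |Aconst l * I1 lam|) * lam⁻¹,
    by positivity, fun Q hQ I hI ho => ?_⟩
  have hQ1 : (1 : ℝ) ≤ Q := by exact_mod_cast hQ
  have hQ0 : (0 : ℝ) < Q := by linarith
  obtain ⟨α, β, h0, hαβ, h1, hs, hs'⟩ := exists_Ioo_subset_subset_Icc hI ho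
  rw [setIntegral_eq_intervalIntegral hαβ hs hs']
  have hT0 : 0 < (Q : ℝ) ^ (-(1 / 6) : ℝ) := by positivity
  rcases lt_or_ge (lam * Q) 1 with hlt | hge
  · have b1 : |∫ x in α..β, 1 / (1 + x ^ 2)| ≤ 1 := abs_integral_inv_one_add_sq_le h0 hαβ h1
    have hQl : (Q : ℝ) ≤ lam⁻¹ := by
      rw [← one_div, le_div_iff₀ hl0]; linarith
    have b2 : |Asum l Q I lam| ≤ lam⁻¹ ^ 2 := by
      rw [abs_of_nonneg (Asum_nonneg _ _ _ _)]
      exact (Asum_le _ _ _ _).trans (by gcongr)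
    have b3 : |Asum l Q I lam - (∫ u in α..β, 1 / (1 + u ^ 2)) * Aconst l * I1 lam| ≤
        lam⁻¹ ^ 2 + |Aconst l * I1 lam| := by
      refine (abs_sub _ _).trans (add_le_add b2 ?_)
      rw [mul_assoc, abs_mul]
      exact mul_le_of_le_one_left (abs_nonneg _) b1
    have b4 : 1 ≤ lam⁻¹ * (Q : ℝ) ^ (-(1 / 6) : ℝ) := by
      have i1 : (Q : ℝ) ^ (-1 : ℝ) ≤ (Q : ℝ) ^ (-(1 / 6) : ℝ) :=
        Real.rpow_le_rpow_of_exponent_le hQ1 (by norm_num)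
      rw [Real.rpow_neg_one] at i1
      calc (1 : ℝ) = Q * (Q : ℝ)⁻¹ := by field_simp
        _ ≤ _ := by gcongr
    calc _ ≤ lam⁻¹ ^ 2 + |Aconst l * I1 lam| := b3
      _ ≤ (lam⁻¹ ^ 2 + |Aconst l * I1 lam|) * (lam⁻¹ * (Q : ℝ) ^ (-(1 / 6) : ℝ)) :=
        le_mul_of_one_le_right (by positivity) b4
      _ = 0 + (lam⁻¹ ^ 2 + |Aconst l * I1 lam|) * lam⁻¹ * (Q : ℝ) ^ (-(1 / 6) : ℝ) := by ring
      _ ≤ (C₁ + 2 * C₂ + 13 * lam⁻¹ ^ 4) * (Q : ℝ) ^ (-(1 / 6) : ℝ) +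
          (lam⁻¹ ^ 2 + |Aconst l * I1 lam|) * lam⁻¹ * (Q : ℝ) ^ (-(1 / 6) : ℝ) := by
        gcongr
        positivity
      _ = _ := by ring
  · have k0 := abs_Asum_sub_sums_le hl (zero_lt_one.trans_le hge) hs hs'
    rw [sum_left_fareyPairs_eq hge h0 h1, sum_left_fareyPairs_eq hge h0 h1,
      sum_right_fareyPairs_eq hge h0 h1] at k0
    have k1 := H₁ Q hQ (-1) (by simp) α β h0 hαβ h1
    have k2 := H₂ Q hQ (-1) (by simp) α β h0 hαβ h1
    have k3 := H₂ Q hQ 1 (by simp) α β h0 hαβ h1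
    have k4 : 12 * (1 / (lam * Q) ^ 2) + (Q : ℝ) ^ 2 * (1 / (lam * Q) ^ 2) ^ 2 ≤
        13 * lam⁻¹ ^ 4 * (Q : ℝ) ^ (-(1 / 6) : ℝ) := by
      have i1 : (Q : ℝ) ^ (-2 : ℝ) ≤ (Q : ℝ) ^ (-(1 / 6) : ℝ) :=
        Real.rpow_le_rpow_of_exponent_le hQ1 (by norm_num)
      rw [Real.rpow_neg hQ0.le, Real.rpow_two] at i1
      have i2 : lam⁻¹ ^ 2 ≤ lam⁻¹ ^ 4 := pow_le_pow_right₀ hl1 (by norm_num)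
      calc _ = 12 * (lam⁻¹ ^ 2 * ((Q : ℝ) ^ 2)⁻¹) + lam⁻¹ ^ 4 * ((Q : ℝ) ^ 2)⁻¹ := by
            field_simp
        _ ≤ 12 * (lam⁻¹ ^ 4 * ((Q : ℝ) ^ 2)⁻¹) + lam⁻¹ ^ 4 * ((Q : ℝ) ^ 2)⁻¹ := by gcongr
        _ = 13 * lam⁻¹ ^ 4 * ((Q : ℝ) ^ 2)⁻¹ := by ring
        _ ≤ _ := by gcongr
    have k5 : 0 ≤ (lam⁻¹ ^ 2 + |Aconst l * I1 lam|) * lam⁻¹ * (Q : ℝ) ^ (-(1 / 6) : ℝ) := by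
      positivity
    have e : (∫ u in α..β, 1 / (1 + u ^ 2)) * Aconst l * I1 lam =
        (∫ u in α..β, 1 / (1 + u ^ 2)) * (Cconst 1 / (1 : ℕ)) * I1 lam -
        2 * ((∫ u in α..β, 1 / (1 + u ^ 2)) * (Cconst l / l) * I1 lam) := by
      rw [Aconst, Cconst_one, Nat.cast_one]
      ring
    rw [e]
    rw [abs_le] at k0 k1 k2 k3 ⊢
    constructor <;> linarith

theorem I1_eq_integral_add {lam t : ℝ} (hlam : lam ∈ Set.Ioc (0 : ℝ) 1) :
    I1 lam = (∫ x in lam..t, kernelExt lam x) + ∫ x in t..1, kernelExt lam x := by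
  have hc : Continuous (kernelExt lam) := by
    refine (LipschitzWith.of_dist_le_mul (K := (2 * lam⁻¹ ^ 3).toNNReal) fun x y => ?_).continuous
    have := hlam.1
    rw [Real.coe_toNNReal _ (by positivity), Real.dist_eq, Real.dist_eq]
    exact abs_kernelExt_sub_le hlam x y
  rw [← integral_kernelExt hlam, intervalIntegral.integral_add_adjacent_intervals
    (hc.intervalIntegrable _ _) (hc.intervalIntegrable _ _)]

theorem integral_kernelExt_of_one_sub_le {lam t : ℝ} (hlam : 0 < lam) (h1 : lam ≤ t) (h2 : t ≤ 1)
    (h3 : 1 - t ≤ lam) :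
    ∫ x in t..1, kernelExt lam x = Real.log t * Real.log lam := by
  have ht := hlam.trans_le h1
  have e : ∫ x in t..1, kernelExt lam x = ∫ x in t..1, x⁻¹ * -Real.log lam := by
    refine intervalIntegral.integral_congr fun x hx => ?_
    rw [Set.uIcc_of_le h2] at hx
    simp only [kernelExt]
    rw [max_eq_right (h1.trans hx.1), min_eq_right (by linarith [hx.1]),
      max_eq_left (by linarith [hx.1])]
  rw [e, intervalIntegral.integral_mul_const, integral_inv_of_pos ht one_pos, one_div,
    Real.log_inv, neg_mul_neg]

theorem I1_of_half_le {lam : ℝ} (hlam : lam ∈ Set.Ioc (0 : ℝ) 1) (h : 1 / 2 ≤ lam) :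
    I1 lam = Real.log lam ^ 2 := by
  rw [← integral_kernelExt hlam, integral_kernelExt_of_one_sub_le hlam.1 le_rfl hlam.2
    (by linarith), pow_two]

theorem I1_of_le_half {lam : ℝ} (hlam : lam ∈ Set.Ioc (0 : ℝ) 1) (h : lam ≤ 1 / 2) :
    I1 lam = Real.log (1 - lam) * Real.log lam +
      ∫ x in lam..(1 - lam), (1 / x) * Real.log (1 / (1 - x)) := by
  have h0 := hlam.1
  rw [I1_eq_integral_add hlam (t := 1 - lam), integral_kernelExt_of_one_sub_le h0 (by linarith)
    (by linarith) (by linarith), add_comm]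
  congr 1
  refine intervalIntegral.integral_congr fun x hx => ?_
  rw [Set.uIcc_of_le (by linarith)] at hx
  simp only [kernelExt]
  rw [max_eq_right hx.1, min_eq_right (by linarith [hx.1]), max_eq_right (by linarith [hx.2]),
    one_div, one_div, Real.log_inv]

theorem statement7 (l : ℕ) (hl : 2 ≤ l) (lam : ℝ) (hlam : lam ∈ Set.Ioc (0 : ℝ) 1)
    (c c₁ δ K : ℝ) (hc : c ∈ Set.Ioo (0 : ℝ) 1) (hc₁ : c₁ ∈ Set.Ioo (0 : ℝ) 1)
    (hδ : 0 < δ) (hK : 1 ≤ K) :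
    (∃ C > 0, ∀ Q : ℕ, 2 ≤ Q → ∀ I : Set ℝ, I ⊆ Set.Icc 0 1 → I.OrdConnected →
      K⁻¹ * (Q : ℝ) ^ (-c) ≤ (volume I).toReal → (volume I).toReal ≤ K * (Q : ℝ) ^ (-c) →
      |Asum l Q I lam - (∫ u in I, 1 / (1 + u ^ 2)) * Aconst l * I1 lam| ≤
        C * (Q : ℝ) ^ (δ + max (max (2 * c₁ - 1 / 2) (-c₁)) (-1))) ∧
    (1 / 2 ≤ lam → I1 lam = (Real.log lam) ^ 2) ∧
    (lam ≤ 1 / 2 → I1 lam = Real.log (1 - lam) * Real.log lam +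
      ∫ x in lam..(1 - lam), (1 / x) * Real.log (1 / (1 - x))) := by
  refine ⟨?_, I1_of_half_le hlam, I1_of_le_half hlam⟩
  obtain ⟨C, hC, H⟩ := exists_abs_Asum_sub_le hl hlam
  refine ⟨C, hC, fun Q hQ I hI ho _ _ => (H Q (by omega) I hI ho).trans ?_⟩
  gcongr
  · exact_mod_cast (by omega : 1 ≤ Q)
  · have h1 := le_max_left (2 * c₁ - 1 / 2) (-c₁)
    have h2 := le_max_right (2 * c₁ - 1 / 2) (-c₁)
    have h3 := le_max_left (max (2 * c₁ - 1 / 2) (-c₁)) (-1)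
    linarith
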